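/- arXiv:0909.0210 — 3 statements merged into one kernel-verified Lean document; each statement's English description precedes it below -/
import Mathlib

section
/- For every t ∈ ℝ, for μ_t-almost every sequence 𝐢 ∈ Σ = D^ℕ, the symbolic local dimension δ_μ(𝐢) and the local dimension d_μ(Π(𝐢)) both exist and δ_μ(𝐢) = d_μ(Π(𝐢)) = α(t). -/
open MeasureTheory Metric Real Set Filter
open scoped ENNReal Topology

noncomputable section BedfordMcMullen

/-- `σ = log m / log n`. -/
def sig (m n : ℕ) : ℝ := Real.log m / Real.log n

/-- `l(k) = ⌊σ k⌋`. -/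
def lk (m n k : ℕ) : ℕ := ⌊sig m n * k⌋₊

/-- The affine contraction `T_{i,j}(x,y) = ((x+j)/n, (y+i)/m)` for the digit `d = (i,j)`. -/
def Tmap (m n : ℕ) (d : ℕ × ℕ) (x : ℝ × ℝ) : ℝ × ℝ :=
  ((x.1 + d.2) / n, (x.2 + d.1) / m)

/-- `Λ` is the Bedford–McMullen carpet: the unique nonempty compact set with
`Λ = ⋃_{d ∈ D} T_d(Λ)`. -/
def IsAttractor (m n : ℕ) (D : Finset (ℕ × ℕ)) (Λ : Set (ℝ × ℝ)) : Prop :=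
  IsCompact Λ ∧ Λ.Nonempty ∧ Λ = ⋃ d ∈ D, Tmap m n d '' Λ

/-- `μ` is the self-affine (Bernoulli) measure with weights `p`. -/
def IsSelfAffine (m n : ℕ) (D : Finset (ℕ × ℕ)) (p : ℕ × ℕ → ℝ)
    (μ : Measure (ℝ × ℝ)) : Prop :=
  ∀ A : Set (ℝ × ℝ), MeasurableSet A →
    μ A = ∑ d ∈ D, ENNReal.ofReal (p d) * μ (Tmap m n d ⁻¹' A)

/-- `q_i = Σ_{j : (i,j) ∈ D} p_{ij}`. -/
def qrow (D : Finset (ℕ × ℕ)) (p : ℕ × ℕ → ℝ) (i : ℕ) : ℝ :=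
  ∑ d ∈ D.filter fun d => d.1 = i, p d

/-- `γ_i(t) = Σ_{j : (i,j) ∈ D} p_{ij}^t`. -/
def gam (D : Finset (ℕ × ℕ)) (p : ℕ × ℕ → ℝ) (t : ℝ) (i : ℕ) : ℝ :=
  ∑ d ∈ D.filter fun d => d.1 = i, p d ^ t

/-- `β` satisfies, for every `t`, the defining equation
`m^{β(t)} Σ_{(i,j)∈D} p_{ij}^t q_i^{(1-σ)t} γ_i^{σ-1} = 1`. -/
def IsBeta (m n : ℕ) (D : Finset (ℕ × ℕ)) (p : ℕ × ℕ → ℝ) (β : ℝ → ℝ) : Prop :=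
  ∀ t : ℝ, (m : ℝ) ^ β t *
      ∑ d ∈ D, p d ^ t * qrow D p d.1 ^ ((1 - sig m n) * t) * gam D p t d.1 ^ (sig m n - 1) = 1

/-- The local dimension of `μ` at `x` exists and equals `α`. -/
def HasLocalDim (μ : Measure (ℝ × ℝ)) (x : ℝ × ℝ) (α : ℝ) : Prop :=
  Tendsto (fun r : ℝ => Real.log (μ (ball x r)).toReal / Real.log r) (𝓝[>] 0) (𝓝 α)

/-- `X_α = {x ∈ Λ : d_μ(x) = α}`. -/
def levelSet (μ : Measure (ℝ × ℝ)) (Λ : Set (ℝ × ℝ)) (α : ℝ) : Set (ℝ × ℝ) :=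
  {x | x ∈ Λ ∧ HasLocalDim μ x α}

/-- `α_min = min_{(i,j)∈D} (−σ log p_{ij} + (σ−1) log q_i)/log m`. -/
def alphaMin (m : ℕ) (D : Finset (ℕ × ℕ)) (p : ℕ × ℕ → ℝ) (σ : ℝ) : ℝ :=
  sInf ((fun d => (-σ * Real.log (p d) + (σ - 1) * Real.log (qrow D p d.1)) / Real.log m) ''
    (D : Set (ℕ × ℕ)))

/-- `α_max = max_{(i,j)∈D} (−σ log p_{ij} + (σ−1) log q_i)/log m`. -/
def alphaMax (m : ℕ) (D : Finset (ℕ × ℕ)) (p : ℕ × ℕ → ℝ) (σ : ℝ) : ℝ :=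
  sSup ((fun d => (-σ * Real.log (p d) + (σ - 1) * Real.log (qrow D p d.1)) / Real.log m) ''
    (D : Set (ℕ × ℕ)))

/-- A digit of `D`. -/
abbrev Digit (D : Finset (ℕ × ℕ)) := {d : ℕ × ℕ // d ∈ D}

/-- The symbol space `Σ = D^ℕ` (indexed from `0`; position `r` of the paper is index `r-1`). -/
abbrev Word (D : Finset (ℕ × ℕ)) := ℕ → Digit D

/-- The natural projection `Π : Σ → ℝ²`. -/
def proj (m n : ℕ) {D : Finset (ℕ × ℕ)} (i : Word D) : ℝ × ℝ :=
  (∑' k : ℕ, ((i k).1.2 : ℝ) * (n : ℝ) ^ (-(k + 1 : ℤ)),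
   ∑' k : ℕ, ((i k).1.1 : ℝ) * (m : ℝ) ^ (-(k + 1 : ℤ)))

/-- The approximate square `R_k(𝐢)`. -/
def approxSq (m n : ℕ) {D : Finset (ℕ × ℕ)} (k : ℕ) (i : Word D) : Set (ℝ × ℝ) :=
  Icc (∑ r ∈ Finset.range (lk m n k), ((i r).1.2 : ℝ) * (n : ℝ) ^ (-(r + 1 : ℤ)))
      (∑ r ∈ Finset.range (lk m n k), ((i r).1.2 : ℝ) * (n : ℝ) ^ (-(r + 1 : ℤ)) +
        (n : ℝ) ^ (-(lk m n k : ℤ))) ×ˢ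
  Icc (∑ r ∈ Finset.range k, ((i r).1.1 : ℝ) * (m : ℝ) ^ (-(r + 1 : ℤ)))
      (∑ r ∈ Finset.range k, ((i r).1.1 : ℝ) * (m : ℝ) ^ (-(r + 1 : ℤ)) + (m : ℝ) ^ (-(k : ℤ)))

/-- `D₁ = √(n² + 1)`. -/
def D1 (n : ℕ) : ℝ := Real.sqrt ((n : ℝ) ^ 2 + 1)

/-- The symbolic local dimension of `μ` along `𝐢` exists and equals `α`. -/
def HasSymbDim (m n : ℕ) {D : Finset (ℕ × ℕ)} (μ : Measure (ℝ × ℝ)) (i : Word D)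
    (α : ℝ) : Prop :=
  Tendsto (fun k : ℕ => -Real.log (μ (approxSq m n k i)).toReal / ((k : ℝ) * Real.log m))
    atTop (𝓝 α)

/-- `R_k(𝐢) ∈ Y(α, ε, k)`, i.e. `m^{-kα(1+ε)} ≤ μ(R_k(𝐢)) ≤ m^{-kα(1-ε)}`. -/
def MemY (m n : ℕ) {D : Finset (ℕ × ℕ)} (μ : Measure (ℝ × ℝ)) (α ε : ℝ) (k : ℕ)
    (i : Word D) : Prop :=
  ENNReal.ofReal ((m : ℝ) ^ (-((k : ℝ) * α * (1 + ε)))) ≤ μ (approxSq m n k i) ∧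
    μ (approxSq m n k i) ≤ ENNReal.ofReal ((m : ℝ) ^ (-((k : ℝ) * α * (1 - ε))))

/-- `P_{ij} = p_{ij}^t m^{β(t)} q_i^{(1−σ)t} γ_i^{σ−1}`. -/
def Pweight (m n : ℕ) (D : Finset (ℕ × ℕ)) (p : ℕ × ℕ → ℝ) (β : ℝ → ℝ) (t : ℝ)
    (d : ℕ × ℕ) : ℝ :=
  p d ^ t * (m : ℝ) ^ β t * qrow D p d.1 ^ ((1 - sig m n) * t) * gam D p t d.1 ^ (sig m n - 1)

/-- `Q_i = Σ_{j : (i,j) ∈ D} P_{ij}`. -/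
def Qrow (m n : ℕ) (D : Finset (ℕ × ℕ)) (p : ℕ × ℕ → ℝ) (β : ℝ → ℝ) (t : ℝ) (i : ℕ) : ℝ :=
  ∑ d ∈ D.filter fun d => d.1 = i, Pweight m n D p β t d

/-- `α(t) = (−σ Σ P_{ij} log p_{ij} − (1−σ) Σ Q_i log q_i)/log m`. -/
def alphaT (m n : ℕ) (D : Finset (ℕ × ℕ)) (p : ℕ × ℕ → ℝ) (β : ℝ → ℝ) (t : ℝ) : ℝ :=
  (-(sig m n) * ∑ d ∈ D, Pweight m n D p β t d * Real.log (p d) -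
      (1 - sig m n) * ∑ i ∈ Finset.range m, Qrow m n D p β t i * Real.log (qrow D p i)) /
    Real.log m

/-- `ν` is the Bernoulli (i.i.d. product) measure on `Σ = D^ℕ` with weights `P`. -/
def IsBernoulli {D : Finset (ℕ × ℕ)} (P : ℕ × ℕ → ℝ) (ν : Measure (Word D)) : Prop :=
  ∀ (k : ℕ) (w : Word D),
    ν {i : Word D | ∀ r < k, i r = w r} = ∏ r ∈ Finset.range k, ENNReal.ofReal (P (w r).1)

/-- `Z_k(𝐢)` (with the convention `inf ∅ = ∞`). -/
def Zk (m n : ℕ) {D : Finset (ℕ × ℕ)} (i : Word D) (k : ℕ) : ℝ≥0∞ :=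
  max (⨅ η ∈ {η : ℕ | 1 ≤ η ∧ (i (k + η - 1)).1.1 ≠ (i k).1.1}, (η : ℝ≥0∞))
    (ENNReal.ofReal (sig m n)⁻¹ *
      ⨅ η ∈ {η : ℕ | 1 ≤ η ∧ (i (lk m n k + η - 1)).1.2 ≠ (i (lk m n k)).1.2}, (η : ℝ≥0∞))

/-- `V_k(𝐢) = inf{l > k : row(i_l) ∉ {0, m−1} or row(i_l) ≠ row(i_{k+1})} − k − 1`. -/
def Vk (m : ℕ) {D : Finset (ℕ × ℕ)} (i : Word D) (k : ℕ) : ℝ≥0∞ :=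
  (⨅ l ∈ {l : ℕ | k < l ∧
      ((i (l - 1)).1.1 ∉ ({0, m - 1} : Set ℕ) ∨ (i (l - 1)).1.1 ≠ (i k).1.1)}, (l : ℝ≥0∞)) -
    ((k : ℝ≥0∞) + 1)

/-- `ω(i,j) = q_i^t γ_i^{−1}`. -/
def omg (D : Finset (ℕ × ℕ)) (p : ℕ × ℕ → ℝ) (t : ℝ) (d : ℕ × ℕ) : ℝ :=
  qrow D p d.1 ^ t * (gam D p t d.1)⁻¹

/-- `B_l(𝐢) = (1/l) Σ_{r=1}^l log ω(i_r)`. -/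
def Bl {D : Finset (ℕ × ℕ)} (p : ℕ × ℕ → ℝ) (t : ℝ) (i : Word D) (l : ℕ) : ℝ :=
  (1 / (l : ℝ)) * ∑ r ∈ Finset.range l, Real.log (omg D p t (i r).1)

/-- `A_k(𝐢) = B_{l(k)}(𝐢) − B_k(𝐢)`. -/
def Ak (m n : ℕ) {D : Finset (ℕ × ℕ)} (p : ℕ × ℕ → ℝ) (t : ℝ) (i : Word D) (k : ℕ) : ℝ :=
  Bl p t i (lk m n k) - Bl p t i k

/-- `R_k(𝐢) ∈ G(α, ε, k) = Y(α,ε,k) ∩ {A_k ≥ −log(1+ε)}`. -/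
def MemG (m n : ℕ) {D : Finset (ℕ × ℕ)} (μ : Measure (ℝ × ℝ)) (p : ℕ × ℕ → ℝ)
    (t α ε : ℝ) (k : ℕ) (i : Word D) : Prop :=
  MemY m n μ α ε k i ∧ -Real.log (1 + ε) ≤ Ak m n p t i k

open Classical in
/-- `Γ_k(𝐢)`: words of length `k` agreeing with `𝐢` on the first `l(k)` digits and with the
rows of `𝐢` on the remaining digits. -/
def GammaSet (m n : ℕ) {D : Finset (ℕ × ℕ)} (k : ℕ) (i : Word D) :
    Finset (Fin k → Digit D) :=
  Finset.univ.filter fun w =>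
    (∀ r : Fin k, (r : ℕ) < lk m n k → w r = i r) ∧
      ∀ r : Fin k, lk m n k ≤ (r : ℕ) → (w r).1.1 = (i (r : ℕ)).1.1

/-- `R̂_k(𝐢)`: the rectangle with the same center as `R_k(𝐢)` whose sides are `2D₁` times
longer. -/
def hatRect (m n : ℕ) {D : Finset (ℕ × ℕ)} (k : ℕ) (i : Word D) : Set (ℝ × ℝ) :=
  Icc (∑ r ∈ Finset.range (lk m n k), ((i r).1.2 : ℝ) * (n : ℝ) ^ (-(r + 1 : ℤ)) +
        (n : ℝ) ^ (-(lk m n k : ℤ)) / 2 - D1 n * (n : ℝ) ^ (-(lk m n k : ℤ)))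
      (∑ r ∈ Finset.range (lk m n k), ((i r).1.2 : ℝ) * (n : ℝ) ^ (-(r + 1 : ℤ)) +
        (n : ℝ) ^ (-(lk m n k : ℤ)) / 2 + D1 n * (n : ℝ) ^ (-(lk m n k : ℤ))) ×ˢ
  Icc (∑ r ∈ Finset.range k, ((i r).1.1 : ℝ) * (m : ℝ) ^ (-(r + 1 : ℤ)) +
        (m : ℝ) ^ (-(k : ℤ)) / 2 - D1 n * (m : ℝ) ^ (-(k : ℤ)))
      (∑ r ∈ Finset.range k, ((i r).1.1 : ℝ) * (m : ℝ) ^ (-(r + 1 : ℤ)) +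
        (m : ℝ) ^ (-(k : ℤ)) / 2 + D1 n * (m : ℝ) ^ (-(k : ℤ)))

/-- Truncated digit expansion. -/
def sB (b : ℕ) (a : ℕ → ℕ) (l : ℕ) : ℝ :=
  ∑ r ∈ Finset.range l, (a r : ℝ) * (b : ℝ) ^ (-(r + 1 : ℤ))

/-- Half-open digit interval. -/
def HI (b : ℕ) (a : ℕ → ℕ) (l : ℕ) : Set ℝ :=
  Ico (sB b a l) (sB b a l + (b : ℝ) ^ (-(l : ℤ)))

lemma zpow_step (b : ℕ) (hb : 2 ≤ b) (l : ℕ) :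
    (b : ℝ) ^ (-(l : ℤ)) = b * (b : ℝ) ^ (-(l + 1 : ℤ)) := by
  have h : (b : ℝ) ≠ 0 := by positivity
  rw [show (-(l : ℤ)) = 1 + (-(l + 1 : ℤ)) by ring, zpow_add₀ h, zpow_one]

lemma sB_succ' (b : ℕ) (hb : 2 ≤ b) (a : ℕ → ℕ) (l : ℕ) :
    sB b a (l + 1) = (a 0 + sB b (fun r => a (r + 1)) l) / b := by
  have h : (b : ℝ) ≠ 0 := by positivity
  unfold sB
  rw [Finset.sum_range_succ', add_comm, add_div, Finset.sum_div]
  congr 1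
  · simp [div_eq_mul_inv]
  · refine Finset.sum_congr rfl fun r _ => ?_
    have := zpow_step b hb (r + 1)
    push_cast at this ⊢
    rw [this]; field_simp

lemma sB_succ (b : ℕ) (a : ℕ → ℕ) (l : ℕ) :
    sB b a (l + 1) = sB b a l + (a l : ℝ) * (b : ℝ) ^ (-(l + 1 : ℤ)) := by
  unfold sB; rw [Finset.sum_range_succ]

lemma sB_mono (b : ℕ) (a : ℕ → ℕ) : Monotone (sB b a) := by
  refine monotone_nat_of_le_succ fun l => ?_
  rw [sB_succ]
  have : (0 : ℝ) ≤ (a l : ℝ) * (b : ℝ) ^ (-(l + 1 : ℤ)) := by positivity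
  linarith

/-- Right end point. -/
def uB (b : ℕ) (a : ℕ → ℕ) (l : ℕ) : ℝ := sB b a l + (b : ℝ) ^ (-(l : ℤ))

lemma uB_step (b : ℕ) (hb : 2 ≤ b) (a : ℕ → ℕ) (l : ℕ) :
    uB b a (l + 1) = uB b a l - ((b : ℝ) - 1 - a l) * (b : ℝ) ^ (-(l + 1 : ℤ)) := by
  unfold uB
  rw [sB_succ, zpow_step b hb l]; push_cast; ring

lemma uB_anti (b : ℕ) (hb : 2 ≤ b) (a : ℕ → ℕ) (ha : ∀ r, a r < b) : Antitone (uB b a) := by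
  refine antitone_nat_of_succ_le fun l => ?_
  rw [uB_step b hb]
  have h1 : (a l : ℝ) + 1 ≤ b := by exact_mod_cast ha l
  have : (0 : ℝ) ≤ ((b : ℝ) - 1 - a l) * (b : ℝ) ^ (-(l + 1 : ℤ)) :=
    mul_nonneg (by linarith) (by positivity)
  linarith

lemma sB_nonneg (b : ℕ) (a : ℕ → ℕ) (l : ℕ) : 0 ≤ sB b a l := by
  unfold sB; positivity

lemma uB_le_one (b : ℕ) (hb : 2 ≤ b) (a : ℕ → ℕ) (ha : ∀ r, a r < b) (l : ℕ) :
    uB b a l ≤ 1 := by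
  have := uB_anti b hb a ha (Nat.zero_le l)
  simpa [uB, sB] using this

lemma HI_pre (b : ℕ) (hb : 2 ≤ b) (a : ℕ → ℕ) (ha : ∀ r, a r < b) (l j : ℕ) (z : ℝ)
    (hz : z ∈ Ico (0 : ℝ) 1) :
    (z + j) / b ∈ HI b a (l + 1) ↔ j = a 0 ∧ z ∈ HI b (fun r => a (r + 1)) l := by
  have h : (0 : ℝ) < b := by positivity
  have h1 := uB_le_one b hb (fun r => a (r + 1)) (fun r => ha _) l
  have h0 := sB_nonneg b (fun r => a (r + 1)) l
  have hs := zpow_step b hb l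
  unfold uB at h1
  unfold HI
  rw [sB_succ' b hb]
  have e : ((a 0 : ℝ) + sB b (fun r => a (r + 1)) l) / b + (b : ℝ) ^ (-((l + 1 : ℕ) : ℤ))
      = (a 0 + (sB b (fun r => a (r + 1)) l + (b : ℝ) ^ (-(l : ℤ)))) / b := by
    rw [hs]; push_cast; field_simp; ring
  rw [e, mem_Ico, mem_Ico, div_le_div_iff_of_pos_right h, div_lt_div_iff_of_pos_right h]
  constructor
  · rintro ⟨h2, h3⟩
    have e1 : (a 0 : ℝ) < j + 1 := by linarith [hz.2]
    have e2 : (j : ℝ) < a 0 + 1 := by linarith [hz.1]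
    have e1' : a 0 < j + 1 := by exact_mod_cast e1
    have e2' : j < a 0 + 1 := by exact_mod_cast e2
    have e3 : j = a 0 := by omega
    subst e3
    exact ⟨rfl, by linarith, by linarith⟩
  · rintro ⟨rfl, h2, h3⟩
    exact ⟨by linarith, by linarith⟩

lemma HI_zero (b : ℕ) (a : ℕ → ℕ) : HI b a 0 = Ico 0 1 := by simp [HI, sB]

lemma HI_pre0 (b : ℕ) (hb : 2 ≤ b) (j : ℕ) (hj : j < b) (z : ℝ)
    (hz : z ∈ Ico (0 : ℝ) 1) : (z + j) / b ∈ Ico (0 : ℝ) 1 := by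
  have h : (0 : ℝ) < b := by positivity
  have h1 : (j : ℝ) + 1 ≤ b := by exact_mod_cast hj
  refine ⟨by have := hz.1; positivity, ?_⟩
  rw [div_lt_one h]; linarith [hz.2]

lemma HI_sub (b : ℕ) (hb : 2 ≤ b) (a : ℕ → ℕ) (ha : ∀ r, a r < b) (l : ℕ) :
    HI b a l ⊆ Ico 0 1 :=
  Ico_subset_Ico (sB_nonneg b a l) (uB_le_one b hb a ha l)

/-- The full expansion. -/
def xB (b : ℕ) (a : ℕ → ℕ) : ℝ := ∑' r : ℕ, (a r : ℝ) * (b : ℝ) ^ (-(r + 1 : ℤ))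

lemma xB_tendsto (b : ℕ) (hb : 2 ≤ b) (a : ℕ → ℕ) (ha : ∀ r, a r < b) :
    Tendsto (sB b a) atTop (𝓝 (xB b a)) := by
  refine Summable.tendsto_sum_tsum_nat (f := fun r : ℕ => (a r : ℝ) * (b : ℝ) ^ (-(r + 1 : ℤ))) ?_
  refine summable_of_sum_range_le (c := 1) (fun r => by positivity) fun l => ?_
  have h := uB_le_one b hb a ha l
  have : (0 : ℝ) ≤ (b : ℝ) ^ (-(l : ℤ)) := by positivity
  unfold uB at h
  change sB b a l ≤ 1
  linarith

lemma le_xB (b : ℕ) (hb : 2 ≤ b) (a : ℕ → ℕ) (ha : ∀ r, a r < b) (l : ℕ) :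
    sB b a l ≤ xB b a := (sB_mono b a).ge_of_tendsto (xB_tendsto b hb a ha) l

lemma xB_le (b : ℕ) (hb : 2 ≤ b) (a : ℕ → ℕ) (ha : ∀ r, a r < b) (l : ℕ) :
    xB b a ≤ uB b a l := by
  refine le_of_tendsto (xB_tendsto b hb a ha) ?_
  filter_upwards [eventually_ge_atTop l] with k hk
  have := uB_anti b hb a ha hk
  have h2 : (0 : ℝ) ≤ (b : ℝ) ^ (-(k : ℤ)) := by positivity
  unfold uB at this ⊢
  linarith

lemma xB_lower (b : ℕ) (hb : 2 ≤ b) (a : ℕ → ℕ) (ha : ∀ r, a r < b) (l h r : ℕ)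
    (h1 : l ≤ r) (h2 : r < l + h) (h3 : a r ≠ 0) :
    sB b a l + (b : ℝ) ^ (-((l + h : ℕ) : ℤ)) ≤ xB b a := by
  have e1 := le_xB b hb a ha (r + 1)
  have e2 := sB_mono b a h1
  rw [sB_succ] at e1
  have e3 : (1 : ℝ) ≤ a r := by exact_mod_cast Nat.one_le_iff_ne_zero.2 h3
  have e4 : (b : ℝ) ^ (-((l + h : ℕ) : ℤ)) ≤ (b : ℝ) ^ (-(r + 1 : ℤ)) :=
    zpow_le_zpow_right₀ (by exact_mod_cast (by omega : 1 ≤ b)) (by push_cast; omega)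
  have e5 : (0 : ℝ) < (b : ℝ) ^ (-(r + 1 : ℤ)) := by positivity
  nlinarith

lemma xB_upper (b : ℕ) (hb : 2 ≤ b) (a : ℕ → ℕ) (ha : ∀ r, a r < b) (l h r : ℕ)
    (h1 : l ≤ r) (h2 : r < l + h) (h3 : a r ≠ b - 1) :
    xB b a ≤ uB b a l - (b : ℝ) ^ (-((l + h : ℕ) : ℤ)) := by
  have e1 := xB_le b hb a ha (r + 1)
  have e2 := uB_anti b hb a ha h1
  rw [uB_step b hb] at e1
  have e3 : (a r : ℝ) + 2 ≤ b := by
    have := ha r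
    exact_mod_cast (by omega : a r + 2 ≤ b)
  have e4 : (b : ℝ) ^ (-((l + h : ℕ) : ℤ)) ≤ (b : ℝ) ^ (-(r + 1 : ℤ)) :=
    zpow_le_zpow_right₀ (by exact_mod_cast (by omega : 1 ≤ b)) (by push_cast; omega)
  have e5 : (0 : ℝ) < (b : ℝ) ^ (-(r + 1 : ℤ)) := by positivity
  nlinarith
/-- One-dimensional self-similar measure with digits `c`. -/
def IsSS (b : ℕ) (D : Finset (ℕ × ℕ)) (p : ℕ × ℕ → ℝ) (c : ℕ × ℕ → ℕ) (ν : Measure ℝ) : Prop :=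
  ∀ A : Set ℝ, MeasurableSet A →
    ν A = ∑ d ∈ D, ENNReal.ofReal (p d) * ν ((fun x : ℝ => (x + c d) / b) ⁻¹' A)

lemma ofReal_sum_one (D : Finset (ℕ × ℕ)) (p : ℕ × ℕ → ℝ) (hp : ∀ d ∈ D, 0 < p d)
    (hp1 : ∑ d ∈ D, p d = 1) : ∑ d ∈ D, ENNReal.ofReal (p d) = 1 := by
  rw [← ENNReal.ofReal_sum_of_nonneg fun d hd => (hp d hd).le, hp1, ENNReal.ofReal_one]

lemma ss_support (b : ℕ) (hb : 2 ≤ b) (D : Finset (ℕ × ℕ)) (p : ℕ × ℕ → ℝ) (c : ℕ × ℕ → ℕ)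
    (hc : ∀ d ∈ D, c d < b) (hp : ∀ d ∈ D, 0 < p d) (hp1 : ∑ d ∈ D, p d = 1)
    (ν : Measure ℝ) [IsProbabilityMeasure ν] (h : IsSS b D p c ν) :
    ν (Icc 0 1)ᶜ = 0 := by
  have hb0 : (0 : ℝ) < b := by positivity
  have step : ∀ R : ℝ, ν (Icc (-R) (1 + R))ᶜ ≤ ν (Icc (-(b * R)) (1 + b * R))ᶜ := by
    intro R
    rw [h _ measurableSet_Icc.compl]
    calc _ ≤ ∑ d ∈ D, ENNReal.ofReal (p d) * ν (Icc (-(b * R)) (1 + b * R))ᶜ := by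
          refine Finset.sum_le_sum fun d hd => ?_
          gcongr
          intro x hx hx'
          apply hx
          have h1 : (c d : ℝ) + 1 ≤ b := by exact_mod_cast hc d hd
          have h2 : (0 : ℝ) ≤ c d := by positivity
          constructor
          · rw [le_div_iff₀ hb0]; nlinarith [hx'.1]
          · rw [div_le_iff₀ hb0]; nlinarith [hx'.2]
      _ = _ := by rw [← Finset.sum_mul, ofReal_sum_one D p hp hp1, one_mul]
  have iter : ∀ (k : ℕ) (R : ℝ), ν (Icc (-R) (1 + R))ᶜ ≤
      ν (Icc (-((b : ℝ) ^ k * R)) (1 + (b : ℝ) ^ k * R))ᶜ := by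
    intro k R
    induction k with
    | zero => simp
    | succ k ih =>
      refine ih.trans ((step _).trans (le_of_eq ?_))
      rw [pow_succ', mul_assoc]
  have zero : ∀ R : ℝ, 0 < R → ν (Icc (-R) (1 + R))ᶜ = 0 := by
    intro R hR
    have hb1 : (1 : ℝ) < b := by exact_mod_cast (by omega : 1 < b)
    have ht : Tendsto (fun k : ℕ => ν (Icc (-((b : ℝ) ^ k * R)) (1 + (b : ℝ) ^ k * R))ᶜ)
        atTop (𝓝 (ν (⋂ k : ℕ, (Icc (-((b : ℝ) ^ k * R)) (1 + (b : ℝ) ^ k * R))ᶜ))) := by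
      refine tendsto_measure_iInter_atTop (fun k => measurableSet_Icc.compl.nullMeasurableSet) ?_
        ⟨0, measure_ne_top _ _⟩
      intro k k' hk
      refine compl_subset_compl.2 (Icc_subset_Icc ?_ ?_)
      · have : (b : ℝ) ^ k ≤ (b : ℝ) ^ k' := pow_le_pow_right₀ hb1.le hk
        nlinarith
      · have : (b : ℝ) ^ k ≤ (b : ℝ) ^ k' := pow_le_pow_right₀ hb1.le hk
        nlinarith
    have he : (⋂ k : ℕ, (Icc (-((b : ℝ) ^ k * R)) (1 + (b : ℝ) ^ k * R))ᶜ) = ∅ := by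
      rw [← compl_iUnion, compl_empty_iff, eq_univ_iff_forall]
      intro x
      obtain ⟨k, hk⟩ := pow_unbounded_of_one_lt (|x| / R) hb1
      rw [div_lt_iff₀ hR] at hk
      have := abs_lt.1 hk
      exact mem_iUnion.2 ⟨k, by linarith, by linarith⟩
    rw [he, measure_empty] at ht
    exact le_antisymm (ge_of_tendsto' ht fun k => iter k R) zero_le
  have : (Icc (0 : ℝ) 1)ᶜ ⊆ ⋃ k : ℕ, (Icc (-(1 / ((k : ℝ) + 1))) (1 + 1 / ((k : ℝ) + 1)))ᶜ := by
    rw [← compl_iInter]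
    refine compl_subset_compl.2 fun x hx => ?_
    rw [mem_iInter] at hx
    have hl := tendsto_one_div_add_atTop_nhds_zero_nat (𝕜 := ℝ)
    constructor
    · refine le_of_tendsto' (by simpa using hl.neg) fun k => (hx k).1
    · refine ge_of_tendsto' (by simpa using hl.const_add 1) fun k => (hx k).2
  refine measure_mono_null this (measure_iUnion_null fun k => zero _ (by positivity))

lemma ss_nonatomic (b : ℕ) (hb : 2 ≤ b) (D : Finset (ℕ × ℕ)) (p : ℕ × ℕ → ℝ) (c : ℕ × ℕ → ℕ)
    (hc : ∃ d ∈ D, ∃ d' ∈ D, c d ≠ c d') (hp : ∀ d ∈ D, 0 < p d) (hp1 : ∑ d ∈ D, p d = 1)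
    (ν : Measure ℝ) [IsProbabilityMeasure ν] (h : IsSS b D p c ν) (x : ℝ) :
    ν {x} = 0 := by
  have hb0 : (0 : ℝ) < b := by positivity
  by_contra hx
  have fin : ∀ y : ℝ, ν {y} ≠ 0 → {z : ℝ | ν {y} ≤ ν {z}}.Finite := by
    intro y hy
    exact Measure.finite_const_le_meas_of_disjoint_iUnion ν (pos_iff_ne_zero.2 hy)
      (As := fun z : ℝ => {z}) (fun z => measurableSet_singleton z)
      (fun a b hab => by simpa [Function.onFun] using hab) (measure_ne_top _ _)
  obtain ⟨y, hy, hmax⟩ := Set.exists_max_image _ (fun z : ℝ => ν {z}) (fin x hx) ⟨x, le_refl (ν {x})⟩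
  have hmax' : ∀ z, ν {z} ≤ ν {y} := by
    intro z
    by_cases hz : ν {x} ≤ ν {z}
    · exact hmax z hz
    · exact (not_le.1 hz).le.trans hy
  have hy0 : ν {y} ≠ 0 := fun h0 => hx (le_antisymm (h0 ▸ hy) zero_le)
  set F := {z : ℝ | ν {y} ≤ ν {z}} with hF
  have hFf : F.Finite := fin y hy0
  have hFn : F.Nonempty := ⟨y, le_refl (ν {y})⟩
  have inv : ∀ z ∈ F, ∀ d ∈ D, b * z - c d ∈ F := by
    intro z hz d hd
    have pre : ∀ d, (fun x : ℝ => (x + c d) / b) ⁻¹' {z} = {b * z - c d} := by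
      intro d; ext w
      simp only [mem_preimage, mem_singleton_iff]
      rw [div_eq_iff hb0.ne']
      constructor <;> intro h <;> linarith
    by_contra hlt
    have hlt : ν {b * z - c d} < ν {y} := not_le.1 hlt
    have e := h {z} (measurableSet_singleton z)
    simp only [pre] at e
    have : ν {z} < ∑ d ∈ D, ENNReal.ofReal (p d) * ν {y} := by
      rw [e, ← Finset.add_sum_erase D _ hd, ← Finset.add_sum_erase D _ hd]
      refine ENNReal.add_lt_add_of_lt_of_le ?_ ?_ ?_
      · exact (ENNReal.sum_lt_top.2 fun d _ =>
          ENNReal.mul_lt_top ENNReal.ofReal_lt_top (measure_lt_top _ _)).ne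
      · exact ENNReal.mul_lt_mul_right (by simpa using hp d hd) ENNReal.ofReal_ne_top hlt
      · exact Finset.sum_le_sum fun d _ => mul_le_mul_right (hmax' _) _
    rw [← Finset.sum_mul, ofReal_sum_one D p hp hp1, one_mul] at this
    exact absurd this (not_lt.2 hz)
  obtain ⟨X, hX, hXm⟩ := Set.exists_max_image F id hFf hFn
  obtain ⟨Y, hY, hYm⟩ := Set.exists_min_image F id hFf hFn
  obtain ⟨d, hd, d', hd', hne⟩ := hc
  have hb1 : (1 : ℝ) < b := by exact_mod_cast (by omega : 1 < b)
  have a1 := hXm _ (inv X hX d hd)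
  have a2 := hXm _ (inv X hX d' hd')
  have a3 := hYm _ (inv Y hY d hd)
  have a4 := hYm _ (inv Y hY d' hd')
  have a5 := hXm _ hY
  simp only [id] at a1 a2 a3 a4 a5
  have : (c d : ℝ) = c d' := by
    apply le_antisymm <;> nlinarith
  exact hne (by exact_mod_cast this)

lemma slln (D : Finset (ℕ × ℕ)) (P : ℕ × ℕ → ℝ) (hP : ∀ d ∈ D, 0 < P d) (hP1 : ∑ d ∈ D, P d = 1)
    (ν : Measure (Word D)) (hν : IsBernoulli P ν) (f : ℕ × ℕ → ℝ) :
    ∀ᵐ i ∂ν, Tendsto (fun k : ℕ => (∑ r ∈ Finset.range k, f (i r).1) / k) atTop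
      (𝓝 (∑ d ∈ D, P d * f d)) := by
  classical
  let ρ : Measure (Digit D) := ∑ d : Digit D, ENNReal.ofReal (P d.1) • Measure.dirac d
  have hρs : ∀ d : Digit D, ρ {d} = ENNReal.ofReal (P d.1) := by
    intro d
    simp only [ρ, Measure.finsetSum_apply, Measure.smul_apply, smul_eq_mul]
    rw [Finset.sum_eq_single d] <;> simp +contextual
  have : IsProbabilityMeasure ρ := by
    constructor
    simp only [ρ, Measure.finsetSum_apply, Measure.smul_apply, smul_eq_mul, measure_univ, mul_one]
    rw [Finset.sum_coe_sort D fun d => ENNReal.ofReal (P d), ofReal_sum_one D P hP hP1]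
  have heq : ν = Measure.infinitePi (fun _ : ℕ => ρ) := by
    refine IsProjectiveLimit.unique (P := fun I : Finset ℕ => Measure.pi (fun _ : I => ρ)) ?_
      (Measure.isProjectiveLimit_infinitePi _)
    rw [isProjectiveLimit_nat_iff (isProjectiveMeasureFamily_pi (fun _ : ℕ => ρ))]
    intro k
    refine Measure.ext_of_singleton fun w => ?_
    rw [Measure.map_apply (by fun_prop) (measurableSet_singleton _)]
    let d0 : Digit D := w ⟨0, by simp⟩
    let w' : Word D := fun r => if h : r ∈ Finset.Iic k then w ⟨r, h⟩ else d0
    have e1 : (Preorder.frestrictLe k : Word D → _) ⁻¹' {w} = {i : Word D | ∀ r < k + 1, i r = w' r} := by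
      ext i
      simp only [mem_preimage, mem_singleton_iff, mem_ofPred_eq]
      constructor
      · rintro rfl r hr
        have : r ≤ k := by omega
        simp [w', this]
      · intro h
        ext1 ⟨r, hr⟩
        have := h r (by have := Finset.mem_Iic.1 hr; omega)
        simp only [w', dif_pos hr] at this
        exact this
    rw [e1, hν (k + 1) w', ← Set.univ_pi_singleton, Measure.pi_pi]
    simp only [hρs]
    rw [show Finset.range (k + 1) = Finset.Iic k by ext; simp, ← Finset.prod_coe_sort]
    refine Finset.prod_congr rfl fun r _ => ?_
    have := r.2
    simp only [w', dif_pos this]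
  rw [heq]
  let X : ℕ → Word D → ℝ := fun r i => f (i r).1
  have hm : Measurable (fun d : Digit D => f d.1) := measurable_of_finite _
  have hint : Integrable (fun d : Digit D => f d.1) ρ := Integrable.of_finite
  have hmp : ∀ r, MeasurePreserving (Function.eval r) (Measure.infinitePi (fun _ : ℕ => ρ)) ρ :=
    fun r => measurePreserving_eval_infinitePi _ r
  have hid : ∀ r, ProbabilityTheory.IdentDistrib (X r) (X 0) (Measure.infinitePi (fun _ : ℕ => ρ))
      (Measure.infinitePi (fun _ : ℕ => ρ)) := by
    intro r
    have : ProbabilityTheory.IdentDistrib (fun i : Word D => i r) (fun i : Word D => i 0)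
        (Measure.infinitePi (fun _ : ℕ => ρ)) (Measure.infinitePi (fun _ : ℕ => ρ)) :=
      ⟨(measurable_pi_apply r).aemeasurable, (measurable_pi_apply 0).aemeasurable, by
        have h1 := (hmp r).map_eq
        have h2 := (hmp 0).map_eq
        exact h1.trans h2.symm⟩
    exact this.comp hm
  have hind : ProbabilityTheory.iIndepFun X (Measure.infinitePi (fun _ : ℕ => ρ)) :=
    ProbabilityTheory.iIndepFun_infinitePi (X := fun (_ : ℕ) (d : Digit D) => f d.1) (fun _ => hm)
  have hX0 : Integrable (X 0) (Measure.infinitePi (fun _ : ℕ => ρ)) :=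
    (hmp 0).integrable_comp_of_integrable hint
  have key := ProbabilityTheory.strong_law_ae_real X hX0 (fun i j hij => hind.indepFun hij) hid
  have hE : ∫ i, X 0 i ∂(Measure.infinitePi (fun _ : ℕ => ρ)) = ∑ d ∈ D, P d * f d := by
    have : ∫ i, X 0 i ∂(Measure.infinitePi (fun _ : ℕ => ρ)) = ∫ d, f d.1 ∂ρ := by
      have h := integral_map (hmp 0).aemeasurable
        (hm.aestronglyMeasurable (μ := Measure.map (Function.eval 0) (Measure.infinitePi (fun _ : ℕ => ρ))))
      rw [(hmp 0).map_eq] at h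
      exact h.symm
    rw [this, integral_fintype hint, ← Finset.sum_coe_sort D (fun d => P d * f d)]
    refine Finset.sum_congr rfl fun d _ => ?_
    rw [measureReal_def, hρs, ENNReal.toReal_ofReal (hP _ d.2).le, smul_eq_mul]
  rw [hE] at key
  exact key
lemma sa_fst (m n : ℕ) (D : Finset (ℕ × ℕ)) (p : ℕ × ℕ → ℝ) (μ : Measure (ℝ × ℝ))
    (hμ : IsSelfAffine m n D p μ) : IsSS n D p Prod.snd (μ.map Prod.fst) := by
  intro A hA
  rw [Measure.map_apply measurable_fst hA, hμ _ (measurable_fst hA)]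
  refine Finset.sum_congr rfl fun d _ => ?_
  rw [Measure.map_apply measurable_fst ((by fun_prop : Measurable fun x : ℝ => (x + d.2) / n) hA)]
  rfl

lemma sa_snd (m n : ℕ) (D : Finset (ℕ × ℕ)) (p : ℕ × ℕ → ℝ) (μ : Measure (ℝ × ℝ))
    (hμ : IsSelfAffine m n D p μ) : IsSS m D p Prod.fst (μ.map Prod.snd) := by
  intro A hA
  rw [Measure.map_apply measurable_snd hA, hμ _ (measurable_snd hA)]
  refine Finset.sum_congr rfl fun d _ => ?_
  rw [Measure.map_apply measurable_snd ((by fun_prop : Measurable fun x : ℝ => (x + d.1) / m) hA)]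
  rfl

/-- Column and row sequences. -/
def colS {D : Finset (ℕ × ℕ)} (i : Word D) (r : ℕ) : ℕ := (i r).1.2
def rowS {D : Finset (ℕ × ℕ)} (i : Word D) (r : ℕ) : ℕ := (i r).1.1

lemma inter_conull (μ : Measure (ℝ × ℝ)) (U : Set (ℝ × ℝ)) (hU : μ Uᶜ = 0) (A B : Set (ℝ × ℝ))
    (h : ∀ z ∈ U, z ∈ A ↔ z ∈ B) : μ A = μ B := by
  refine measure_congr ?_
  have : ∀ᵐ z ∂μ, z ∈ U := hU
  filter_upwards [this] with z hz
  exact propext (h z hz)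

lemma meas_box (m n : ℕ) (hm : 2 ≤ m) (hn : 2 ≤ n)
    (D : Finset (ℕ × ℕ)) (hD : ∀ d ∈ D, d.1 < m ∧ d.2 < n)
    (p : ℕ × ℕ → ℝ) (hp : ∀ d ∈ D, 0 < p d)
    (μ : Measure (ℝ × ℝ)) [IsProbabilityMeasure μ] (hμ : IsSelfAffine m n D p μ)
    (hU : μ (Ico (0 : ℝ) 1 ×ˢ Ico (0 : ℝ) 1)ᶜ = 0) (l h : ℕ) (i : Word D) :
    μ (HI n (colS i) l ×ˢ HI m (rowS i) (l + h)) =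
      (∏ r ∈ Finset.range l, ENNReal.ofReal (p (i r).1)) *
        ∏ r ∈ Finset.range h, ENNReal.ofReal (qrow D p (i (l + r)).1.1) := by
  have hc : ∀ (i : Word D) r, colS i r < n := fun i r => (hD _ (i r).2).2
  have hr : ∀ (i : Word D) r, rowS i r < m := fun i r => (hD _ (i r).2).1
  have hmeas : ∀ (i : Word D) l k, MeasurableSet (HI n (colS i) l ×ˢ HI m (rowS i) k) :=
    fun i l k => measurableSet_Ico.prod measurableSet_Ico
  induction l generalizing i with
  | zero =>
    simp only [zero_add, Finset.range_zero, Finset.prod_empty, one_mul]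
    induction h generalizing i with
    | zero =>
      simp only [HI_zero, Finset.range_zero, Finset.prod_empty]
      exact (prob_compl_eq_zero_iff (measurableSet_Ico.prod measurableSet_Ico)).1 hU
    | succ h ih =>
      rw [hμ _ (hmeas _ _ _)]
      have e : ∀ d ∈ D, ENNReal.ofReal (p d) *
          μ (Tmap m n d ⁻¹' (HI n (colS i) 0 ×ˢ HI m (rowS i) (h + 1))) =
          if d.1 = (i 0).1.1 then ENNReal.ofReal (p d) *
            μ (HI n (colS fun r => i (r + 1)) 0 ×ˢ HI m (rowS fun r => i (r + 1)) h) else 0 := by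
        intro d hd
        split_ifs with hd0
        · congr 1
          refine inter_conull μ _ hU _ _ fun z hz => ?_
          simp only [mem_preimage, mem_prod, Tmap, HI_zero,
            HI_pre m hm _ (hr i) h d.1 z.2 hz.2, HI_pre0 n hn d.2 (hD d hd).2 z.1 hz.1, hz.1]
          simp only [rowS, hd0, true_and]; rfl
        · rw [inter_conull μ _ hU _ ∅, measure_empty, mul_zero]
          intro z hz
          simp only [mem_preimage, mem_prod, Tmap, HI_pre m hm _ (hr i) h d.1 z.2 hz.2]
          simp [rowS, hd0]
      rw [Finset.sum_congr rfl e, ← Finset.sum_filter, ← Finset.sum_mul, ih,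
        ← ENNReal.ofReal_sum_of_nonneg, Finset.prod_range_succ', mul_comm]
      · rfl
      · intro d hd; exact (hp d (Finset.mem_filter.1 hd).1).le
  | succ l ih =>
    rw [hμ _ (hmeas _ _ _)]
    have e : ∀ d ∈ D, d ≠ (i 0).1 → ENNReal.ofReal (p d) *
        μ (Tmap m n d ⁻¹' (HI n (colS i) (l + 1) ×ˢ HI m (rowS i) (l + 1 + h))) = 0 := by
      intro d hd hd0
      rw [inter_conull μ _ hU _ ∅, measure_empty, mul_zero]
      intro z hz
      rw [show l + 1 + h = l + h + 1 by ring]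
      simp only [mem_preimage, mem_prod, Tmap, HI_pre m hm _ (hr i) (l + h) d.1 z.2 hz.2,
        HI_pre n hn _ (hc i) l d.2 z.1 hz.1, mem_empty_iff_false, iff_false]
      rintro ⟨⟨h1, -⟩, h2, -⟩
      exact hd0 (Prod.ext h2 h1)
    rw [Finset.sum_eq_single_of_mem (i 0).1 (i 0).2 e, Finset.prod_range_succ', mul_comm _
      (ENNReal.ofReal (p (i 0).1)), mul_assoc]
    congr 1
    have ih' := ih fun r => i (r + 1)
    rw [inter_conull μ _ hU _ (HI n (colS fun r => i (r + 1)) l ×ˢ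
      HI m (rowS fun r => i (r + 1)) (l + h)), ih']
    · congr 1
      refine Finset.prod_congr rfl fun r _ => ?_
      rw [show l + 1 + r = l + r + 1 by ring]
    · intro z hz
      rw [show l + 1 + h = l + h + 1 by ring]
      simp only [mem_preimage, mem_prod, Tmap, HI_pre m hm _ (hr i) (l + h) _ z.2 hz.2,
        HI_pre n hn _ (hc i) l _ z.1 hz.1]
      simp only [colS, rowS, true_and]; rfl

lemma avg_comp (S : ℕ → ℝ) (A s : ℝ) (g : ℕ → ℕ) (hS : Tendsto (fun k : ℕ => S k / k) atTop (𝓝 A))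
    (hg : Tendsto g atTop atTop) (hs : Tendsto (fun k : ℕ => (g k : ℝ) / k) atTop (𝓝 s)) :
    Tendsto (fun k : ℕ => S (g k) / k) atTop (𝓝 (A * s)) := by
  refine ((hS.comp hg).mul hs).congr' ?_
  filter_upwards [hg.eventually_gt_atTop 0] with k hk
  have : (g k : ℝ) ≠ 0 := by positivity
  simp only [Function.comp]
  field_simp

lemma floor_lim (a : ℝ) (ha : 0 ≤ a) :
    Tendsto (fun k : ℕ => (⌊a * k⌋₊ : ℝ) / k) atTop (𝓝 a) :=
  (tendsto_nat_floor_mul_div_atTop ha).comp tendsto_natCast_atTop_atTop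

lemma run_lemma (Q ε : ℝ) (hε : 0 < ε) (hQ : Q < 1) (S : ℕ → Prop) [DecidablePred S]
    (h : Tendsto (fun k : ℕ => (∑ r ∈ Finset.range k, if S r then (1 : ℝ) else 0) / k) atTop (𝓝 Q)) :
    ∀ᶠ L : ℕ in atTop, ∃ r, L ≤ r ∧ r < L + ⌊ε * L⌋₊ ∧ ¬ S r := by
  have hf := floor_lim ε hε.le
  have hg : Tendsto (fun k : ℕ => k + ⌊ε * k⌋₊) atTop atTop :=
    tendsto_atTop_mono (fun k => Nat.le_add_right k _) tendsto_id
  have hs : Tendsto (fun k : ℕ => ((k + ⌊ε * k⌋₊ : ℕ) : ℝ) / k) atTop (𝓝 (1 + ε)) := by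
    refine (hf.const_add 1).congr' ?_
    filter_upwards [eventually_gt_atTop 0] with k hk
    have : (k : ℝ) ≠ 0 := by positivity
    push_cast; field_simp
  have h1 := (avg_comp _ Q _ _ h hg hs).sub h
  have h2 := hf.sub h1
  have h3 : 0 < ε - (Q * (1 + ε) - Q) := by nlinarith
  filter_upwards [h2.eventually (lt_mem_nhds h3), eventually_gt_atTop 0] with L hL hL0
  by_contra hcon
  push Not at hcon
  rw [Finset.sum_range_add] at hL
  have : ∑ r ∈ Finset.range ⌊ε * L⌋₊, (if S (L + r) then (1 : ℝ) else 0) = ⌊ε * L⌋₊ := by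
    rw [Finset.sum_congr rfl (g := fun _ => (1 : ℝ))]
    · simp
    · intro r hr
      rw [if_pos (hcon _ (by omega) (by have := Finset.mem_range.1 hr; omega))]
  rw [this] at hL
  rw [add_div] at hL
  linarith
lemma local_dim (μ : Measure (ℝ × ℝ)) [IsProbabilityMeasure μ] (x : ℝ × ℝ) (m : ℕ) (hm : 2 ≤ m)
    (C : ℕ) (R : ℕ → Set (ℝ × ℝ)) (hpos : ∀ k, 0 < (μ (R k)).toReal) (α : ℝ)
    (hα : Tendsto (fun k : ℕ => -Real.log (μ (R k)).toReal / ((k : ℝ) * Real.log m)) atTop (𝓝 α))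
    (hin : ∀ (k : ℕ) (r : ℝ), (m : ℝ) ^ (-(k : ℝ) + C) < r → R k ⊆ ball x r)
    (hout : ∀ ε : ℝ, 0 < ε → ∀ᶠ k : ℕ in atTop,
      ball x ((m : ℝ) ^ (-((k : ℝ) * (1 + ε)))) ⊆ R k) :
    HasLocalDim μ x α := by
  have hm1 : (1 : ℝ) < m := by exact_mod_cast (by omega : 1 < m)
  have hm0 : (0 : ℝ) < m := by linarith
  have hlog : 0 < Real.log m := Real.log_pos hm1
  set L : ℝ → ℝ := fun r => -Real.log r / Real.log m with hL
  have hLt : Tendsto L (𝓝[>] 0) atTop :=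
    (tendsto_neg_atBot_atTop.comp Real.tendsto_log_nhdsGT_zero).atTop_div_const hlog
  have hr : ∀ r : ℝ, 0 < r → r = (m : ℝ) ^ (-L r) := by
    intro r hr
    rw [Real.rpow_def_of_pos hm0, hL]
    have : Real.log m * -(-Real.log r / Real.log m) = Real.log r := by field_simp
    rw [this, Real.exp_log hr]
  have hmono : ∀ A B : Set (ℝ × ℝ), A ⊆ B → 0 < (μ A).toReal →
      Real.log (μ A).toReal ≤ Real.log (μ B).toReal := fun A B hAB h0 =>
    Real.log_le_log h0 (ENNReal.toReal_mono (measure_ne_top _ _) (measure_mono hAB))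
  have hr1 : ∀ᶠ r : ℝ in 𝓝[>] 0, 0 < r ∧ r < 1 := Ioo_mem_nhdsGT one_pos
  have hgen : ∀ (K : ℝ → ℕ) (s : ℝ), Tendsto K (𝓝[>] 0) atTop →
      Tendsto (fun r => (K r : ℝ) / L r) (𝓝[>] 0) (𝓝 s) →
      Tendsto (fun r => Real.log (μ (R (K r))).toReal / Real.log r) (𝓝[>] 0) (𝓝 (α * s)) := by
    intro K s hK hs
    refine ((hα.comp hK).mul hs).congr' ?_
    filter_upwards [hr1, hK.eventually_gt_atTop 0] with r hr1 hK0
    have h1 : Real.log r ≠ 0 := (Real.log_neg hr1.1 hr1.2).ne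
    have h2 : (K r : ℝ) ≠ 0 := by positivity
    simp only [Function.comp, hL]
    field_simp
  have hin' : ∀ r : ℝ, 0 < r → R (⌊L r⌋₊ + C + 1) ⊆ ball x r := by
    intro r h0
    apply hin
    conv_rhs => rw [hr r h0]
    refine Real.rpow_lt_rpow_of_exponent_lt hm1 ?_
    have := Nat.lt_floor_add_one (L r)
    push_cast; linarith
  unfold HasLocalDim
  refine tendsto_order.2 ⟨fun a ha => ?_, fun a ha => ?_⟩
  · -- lower bound
    obtain ⟨ε, hε, hε'⟩ : ∃ ε : ℝ, 0 < ε ∧ a < α * (1 + ε)⁻¹ := by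
      have : Tendsto (fun ε : ℝ => α * (1 + ε)⁻¹) (𝓝[>] 0) (𝓝 α) := by
        have hc : ContinuousAt (fun ε : ℝ => α * (1 + ε)⁻¹) 0 := by
          refine ContinuousAt.mul continuousAt_const (ContinuousAt.inv₀ (by fun_prop) (by norm_num))
        have := hc.tendsto
        simp only [add_zero, inv_one, mul_one] at this
        exact this.mono_left nhdsWithin_le_nhds
      obtain ⟨ε, h1, h2⟩ := ((this.eventually (lt_mem_nhds ha)).and self_mem_nhdsWithin).exists
      exact ⟨ε, h2, h1⟩
    have hK : Tendsto (fun r => ⌊(1 + ε)⁻¹ * L r⌋₊) (𝓝[>] 0) atTop :=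
      tendsto_nat_floor_atTop.comp (hLt.const_mul_atTop (by positivity))
    have hs := (tendsto_nat_floor_mul_div_atTop (R := ℝ) (a := (1 + ε)⁻¹) (by positivity)).comp hLt
    have := hgen _ _ hK hs
    filter_upwards [this.eventually (lt_mem_nhds hε'), hr1, hK.eventually (hout ε hε),
      hLt.eventually_ge_atTop 0] with r h1 h2 h3 h4
    refine h1.trans_le ?_
    have hsub : ball x r ⊆ R ⌊(1 + ε)⁻¹ * L r⌋₊ := by
      refine (ball_subset_ball ?_).trans h3
      conv_lhs => rw [hr r h2.1]
      refine Real.rpow_le_rpow_of_exponent_le hm1.le ?_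
      have := Nat.floor_le (show 0 ≤ (1 + ε)⁻¹ * L r by positivity)
      rw [inv_mul_eq_div, le_div_iff₀ (by positivity)] at this
      rw [inv_mul_eq_div]
      linarith
    have hb0 : 0 < (μ (ball x r)).toReal := (hpos _).trans_le
      (ENNReal.toReal_mono (measure_ne_top _ _) (measure_mono (hin' r h2.1)))
    exact div_le_div_of_nonpos_of_le (Real.log_neg h2.1 h2.2).le (hmono _ _ hsub hb0)
  · have hK : Tendsto (fun r => ⌊L r⌋₊ + C + 1) (𝓝[>] 0) atTop :=
      tendsto_atTop_mono (fun r => show ⌊L r⌋₊ ≤ ⌊L r⌋₊ + C + 1 by omega) (tendsto_nat_floor_atTop.comp hLt)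
    have hs : Tendsto (fun r => ((⌊L r⌋₊ + C + 1 : ℕ) : ℝ) / L r) (𝓝[>] 0) (𝓝 1) := by
      have h1 := (tendsto_nat_floor_mul_div_atTop (R := ℝ) (a := 1) (by positivity)).comp hLt
      have h2 : Tendsto (fun r => ((C : ℝ) + 1) / L r) (𝓝[>] 0) (𝓝 0) := hLt.const_div_atTop _
      have := h1.add h2
      rw [add_zero] at this
      refine this.congr fun r => ?_
      simp only [Function.comp, one_mul]
      push_cast; ring
    have := hgen _ _ hK hs
    rw [mul_one] at this
    filter_upwards [this.eventually (gt_mem_nhds ha), hr1] with r h1 h2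
    refine lt_of_le_of_lt ?_ h1
    exact div_le_div_of_nonpos_of_le (Real.log_neg h2.1 h2.2).le (hmono _ _ (hin' r h2.1) (hpos _))

lemma ndiff (m n : ℕ) (hm : 2 ≤ m) (hmn : m < n) (x : ℝ) :
    (n : ℝ) ^ (sig m n * x) = (m : ℝ) ^ x := by
  have hm1 : (1 : ℝ) < m := by exact_mod_cast (by omega : 1 < m)
  have hn1 : (1 : ℝ) < n := by exact_mod_cast (by omega : 1 < n)
  have h2 := Real.log_pos hn1
  rw [Real.rpow_def_of_pos (by linarith), Real.rpow_def_of_pos (by linarith), sig]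
  congr 1
  field_simp

lemma sig_bounds (m n : ℕ) (hm : 2 ≤ m) (hmn : m < n) : 0 < sig m n ∧ sig m n < 1 := by
  have hm1 : (1 : ℝ) < m := by exact_mod_cast (by omega : 1 < m)
  have hn1 : (1 : ℝ) < n := by exact_mod_cast (by omega : 1 < n)
  have h1 := Real.log_pos hm1
  have h2 := Real.log_pos hn1
  refine ⟨div_pos h1 h2, (div_lt_one h2).2 (Real.log_lt_log (by linarith) (by exact_mod_cast hmn))⟩

lemma lk_le (m n : ℕ) (hm : 2 ≤ m) (hmn : m < n) (k : ℕ) : lk m n k ≤ k := by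
  obtain ⟨h0, h1⟩ := sig_bounds m n hm hmn
  refine Nat.floor_le_of_le ?_
  have : (0 : ℝ) ≤ k := by positivity
  nlinarith

lemma approx_meas (m n : ℕ) (hm : 2 ≤ m) (hmn : m < n)
    (D : Finset (ℕ × ℕ)) (hD : ∀ d ∈ D, d.1 < m ∧ d.2 < n)
    (hrow : ∃ d ∈ D, ∃ d' ∈ D, d.1 ≠ d'.1)
    (hcol : ∃ d ∈ D, ∃ d' ∈ D, d.2 ≠ d'.2)
    (p : ℕ × ℕ → ℝ) (hp : ∀ d ∈ D, 0 < p d) (hp1 : ∑ d ∈ D, p d = 1)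
    (μ : Measure (ℝ × ℝ)) [IsProbabilityMeasure μ] (hμ : IsSelfAffine m n D p μ)
    (k : ℕ) (i : Word D) :
    μ (approxSq m n k i) = (∏ r ∈ Finset.range (lk m n k), ENNReal.ofReal (p (i r).1)) *
        ∏ r ∈ Finset.range (k - lk m n k), ENNReal.ofReal (qrow D p (i (lk m n k + r)).1.1) := by
  have hn : 2 ≤ n := by omega
  have i1 : IsProbabilityMeasure (μ.map Prod.fst) :=
    Measure.isProbabilityMeasure_map measurable_fst.aemeasurable
  have i2 : IsProbabilityMeasure (μ.map Prod.snd) :=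
    Measure.isProbabilityMeasure_map measurable_snd.aemeasurable
  have a1 : ∀ c : ℝ, ∀ᵐ z ∂μ, z.1 ≠ c := by
    intro c
    have := ss_nonatomic n hn D p Prod.snd hcol hp hp1 _ (sa_fst m n D p μ hμ) c
    rw [Measure.map_apply measurable_fst (measurableSet_singleton c)] at this
    exact measure_eq_zero_iff_ae_notMem.1 this
  have a2 : ∀ c : ℝ, ∀ᵐ z ∂μ, z.2 ≠ c := by
    intro c
    have := ss_nonatomic m hm D p Prod.fst hrow hp hp1 _ (sa_snd m n D p μ hμ) c
    rw [Measure.map_apply measurable_snd (measurableSet_singleton c)] at this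
    exact measure_eq_zero_iff_ae_notMem.1 this
  have b1 : ∀ᵐ z ∂μ, z.1 ∈ Icc (0 : ℝ) 1 := by
    have := ss_support n hn D p Prod.snd (fun d hd => (hD d hd).2) hp hp1 _ (sa_fst m n D p μ hμ)
    rw [Measure.map_apply measurable_fst measurableSet_Icc.compl] at this
    exact this
  have b2 : ∀ᵐ z ∂μ, z.2 ∈ Icc (0 : ℝ) 1 := by
    have := ss_support m hm D p Prod.fst (fun d hd => (hD d hd).1) hp hp1 _ (sa_snd m n D p μ hμ)
    rw [Measure.map_apply measurable_snd measurableSet_Icc.compl] at this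
    exact this
  have hU : μ (Ico (0 : ℝ) 1 ×ˢ Ico (0 : ℝ) 1)ᶜ = 0 := by
    have : ∀ᵐ z ∂μ, z ∈ Ico (0 : ℝ) 1 ×ˢ Ico (0 : ℝ) 1 := by
      filter_upwards [a1 1, a2 1, b1, b2] with z h1 h2 h3 h4
      exact ⟨⟨h3.1, lt_of_le_of_ne h3.2 h1⟩, ⟨h4.1, lt_of_le_of_ne h4.2 h2⟩⟩
    exact this
  rw [← meas_box m n hm hn D hD p hp μ hμ hU, Nat.add_sub_cancel' (lk_le m n hm hmn k)]
  refine measure_congr ?_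
  filter_upwards [a1 (uB n (colS i) (lk m n k)), a2 (uB m (rowS i) k)] with z h1 h2
  refine propext ⟨fun h => ?_, fun h => ?_⟩
  · exact ⟨⟨h.1.1, lt_of_le_of_ne h.1.2 h1⟩, ⟨h.2.1, lt_of_le_of_ne h.2.2 h2⟩⟩
  · exact ⟨⟨h.1.1, h.1.2.le⟩, ⟨h.2.1, h.2.2.le⟩⟩

lemma qrow_pos (D : Finset (ℕ × ℕ)) (p : ℕ × ℕ → ℝ) (hp : ∀ d ∈ D, 0 < p d) (d : ℕ × ℕ)
    (hd : d ∈ D) : 0 < qrow D p d.1 :=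
  Finset.sum_pos (fun e he => hp e (Finset.mem_filter.1 he).1) ⟨d, by simp [hd]⟩

lemma gam_pos (D : Finset (ℕ × ℕ)) (p : ℕ × ℕ → ℝ) (hp : ∀ d ∈ D, 0 < p d) (t : ℝ) (d : ℕ × ℕ)
    (hd : d ∈ D) : 0 < gam D p t d.1 :=
  Finset.sum_pos (fun e he => Real.rpow_pos_of_pos (hp e (Finset.mem_filter.1 he).1) t)
    ⟨d, by simp [hd]⟩

lemma freq_lt (D : Finset (ℕ × ℕ)) (P : ℕ × ℕ → ℝ) (hP : ∀ d ∈ D, 0 < P d)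
    (hP1 : ∑ d ∈ D, P d = 1) (S : ℕ × ℕ → Prop) [DecidablePred S] (h : ∃ d ∈ D, ¬ S d) :
    ∑ d ∈ D, P d * (if S d then (1 : ℝ) else 0) < 1 := by
  obtain ⟨d, hd, hS⟩ := h
  refine lt_of_lt_of_eq ?_ hP1
  refine Finset.sum_lt_sum (fun e he => ?_) ⟨d, hd, ?_⟩
  · split_ifs <;> linarith [hP e he]
  · simpa [hS] using hP d hd

theorem symbolic_and_real_local_dim_ae
    (m n : ℕ) (hm : 2 ≤ m) (hmn : m < n)
    (D : Finset (ℕ × ℕ)) (hD : ∀ d ∈ D, d.1 < m ∧ d.2 < n)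
    (hrow : ∃ d ∈ D, ∃ d' ∈ D, d.1 ≠ d'.1)
    (hcol : ∃ d ∈ D, ∃ d' ∈ D, d.2 ≠ d'.2)
    (p : ℕ × ℕ → ℝ) (hp : ∀ d ∈ D, 0 < p d) (hp1 : ∑ d ∈ D, p d = 1)
    (μ : Measure (ℝ × ℝ)) (hμ1 : IsProbabilityMeasure μ) (hμ : IsSelfAffine m n D p μ)
    (Λ : Set (ℝ × ℝ)) (hΛ : IsAttractor m n D Λ)
    (β : ℝ → ℝ) (hβ : IsBeta m n D p β)
    (μt : ℝ → Measure (Word D))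
    (hμt : ∀ t : ℝ, IsBernoulli (Pweight m n D p β t) (μt t)) :
    ∀ t : ℝ, ∀ᵐ i ∂ μt t,
      HasSymbDim m n μ i (alphaT m n D p β t) ∧
        HasLocalDim μ (proj m n i) (alphaT m n D p β t) := by
  intro t
  have hn : 2 ≤ n := by omega
  have hm1 : (1 : ℝ) < m := by exact_mod_cast (by omega : 1 < m)
  have hn1 : (1 : ℝ) < n := by exact_mod_cast (by omega : 1 < n)
  have hlogm : 0 < Real.log m := Real.log_pos hm1
  obtain ⟨hs0, hs1⟩ := sig_bounds m n hm hmn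
  set P := Pweight m n D p β t with hPdef
  have hP : ∀ d ∈ D, 0 < P d := by
    intro d hd
    have h1 := Real.rpow_pos_of_pos (hp d hd) t
    have h2 := Real.rpow_pos_of_pos (qrow_pos D p hp d hd) ((1 - sig m n) * t)
    have h3 := Real.rpow_pos_of_pos (gam_pos D p hp t d hd) (sig m n - 1)
    have h4 : (0 : ℝ) < (m : ℝ) ^ β t := Real.rpow_pos_of_pos (by linarith) _
    simp only [hPdef, Pweight]
    positivity
  have hP1 : ∑ d ∈ D, P d = 1 := by
    rw [← hβ t, Finset.mul_sum]
    refine Finset.sum_congr rfl fun d _ => ?_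
    simp only [hPdef, Pweight]; ring
  have SL := slln D P hP hP1 (μt t) (hμt t)
  have hne1 : ∀ a : ℕ, ∃ d ∈ D, ¬ (d.1 = a) := by
    intro a
    obtain ⟨d, hd, d', hd', hne⟩ := hrow
    by_cases h : d.1 = a
    · exact ⟨d', hd', fun h' => hne (h.trans h'.symm)⟩
    · exact ⟨d, hd, h⟩
  have hne2 : ∀ a : ℕ, ∃ d ∈ D, ¬ (d.2 = a) := by
    intro a
    obtain ⟨d, hd, d', hd', hne⟩ := hcol
    by_cases h : d.2 = a
    · exact ⟨d', hd', fun h' => hne (h.trans h'.symm)⟩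
    · exact ⟨d, hd, h⟩
  filter_upwards [SL fun d => Real.log (p d), SL fun d => Real.log (qrow D p d.1),
    SL fun d => if d.1 = 0 then 1 else 0, SL fun d => if d.1 = m - 1 then 1 else 0,
    SL fun d => if d.2 = 0 then 1 else 0, SL fun d => if d.2 = n - 1 then 1 else 0]
    with i h1 h2 h3 h4 h5 h6
  have hc : ∀ r, colS i r < n := fun r => (hD _ (i r).2).2
  have hr : ∀ r, rowS i r < m := fun r => (hD _ (i r).2).1
  have hmeas : ∀ k, (μ (approxSq m n k i)).toReal =
      (∏ r ∈ Finset.range (lk m n k), p (i r).1) *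
        ∏ r ∈ Finset.range (k - lk m n k), qrow D p (i (lk m n k + r)).1.1 := by
    intro k
    rw [approx_meas m n hm hmn D hD hrow hcol p hp hp1 μ hμ, ENNReal.toReal_mul,
      ENNReal.toReal_prod, ENNReal.toReal_prod]
    congr 1
    · exact Finset.prod_congr rfl fun r _ => ENNReal.toReal_ofReal (hp _ (i r).2).le
    · exact Finset.prod_congr rfl fun r _ =>
        ENNReal.toReal_ofReal (qrow_pos D p hp _ (i (lk m n k + r)).2).le
  have hpp : ∀ k, 0 < ∏ r ∈ Finset.range k, p (i r).1 := fun k =>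
    Finset.prod_pos fun r _ => hp _ (i r).2
  have hqp : ∀ l k, 0 < ∏ r ∈ Finset.range k, qrow D p (i (l + r)).1.1 := fun l k =>
    Finset.prod_pos fun r _ => qrow_pos D p hp _ (i (l + r)).2
  have hpos : ∀ k, 0 < (μ (approxSq m n k i)).toReal := by
    intro k; rw [hmeas]; exact mul_pos (hpp _) (hqp _ _)
  have hlk : Tendsto (fun k : ℕ => (lk m n k : ℝ) / k) atTop (𝓝 (sig m n)) :=
    floor_lim _ hs0.le
  have hlk' : Tendsto (fun k : ℕ => lk m n k) atTop atTop :=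
    tendsto_nat_floor_atTop.comp (tendsto_natCast_atTop_atTop.const_mul_atTop hs0)
  have hsymb : HasSymbDim m n μ i (alphaT m n D p β t) := by
    have g1 := avg_comp (fun k => ∑ r ∈ Finset.range k, Real.log (p (i r).1)) _ _ _ h1 hlk' hlk
    have g2 := avg_comp (fun k => ∑ r ∈ Finset.range k, Real.log (qrow D p (i r).1.1)) _ _ _
      h2 hlk' hlk
    have g3 := (((g1.add h2).sub g2).neg).div_const (Real.log m)
    have hQ : ∑ a ∈ Finset.range m, Qrow m n D p β t a * Real.log (qrow D p a) =
        ∑ d ∈ D, P d * Real.log (qrow D p d.1) := by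
      rw [← Finset.sum_fiberwise_of_maps_to (g := Prod.fst) (t := Finset.range m)
        fun d hd => Finset.mem_range.2 (hD d hd).1]
      refine Finset.sum_congr rfl fun a _ => ?_
      rw [Qrow, Finset.sum_mul]
      refine Finset.sum_congr rfl fun d hd => ?_
      rw [(Finset.mem_filter.1 hd).2]
    unfold HasSymbDim alphaT
    rw [hQ]
    convert g3 using 1
    · ext k
      rw [hmeas, Real.log_mul (hpp _).ne' (hqp _ _).ne',
        Real.log_prod fun r _ => (hp _ (i r).2).ne',
        Real.log_prod fun r _ => (qrow_pos D p hp _ (i (lk m n k + r)).2).ne']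
      have : ∑ r ∈ Finset.range k, Real.log (qrow D p (i r).1.1) =
          ∑ r ∈ Finset.range (lk m n k), Real.log (qrow D p (i r).1.1) +
          ∑ r ∈ Finset.range (k - lk m n k), Real.log (qrow D p (i (lk m n k + r)).1.1) := by
        rw [← Finset.sum_range_add, Nat.add_sub_cancel' (lk_le m n hm hmn k)]
      rw [this, ← div_div]
      congr 1
      ring
    · congr 1
      congr 1
      ring
  refine ⟨hsymb, local_dim μ (proj m n i) m hm n (fun k => approxSq m n k i) hpos _ hsymb ?_ ?_⟩
  · -- inner inclusion
    intro k r hkr z hz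
    have hmk : (m : ℝ) ^ (-(k : ℝ)) ≤ (m : ℝ) ^ (-(k : ℝ) + n) :=
      Real.rpow_le_rpow_of_exponent_le hm1.le (by linarith)
    have hnk : (n : ℝ) ^ (-(lk m n k : ℤ)) ≤ (m : ℝ) ^ (-(k : ℝ) + n) := by
      have e1 : (n : ℝ) ^ (-(lk m n k : ℤ)) = (n : ℝ) ^ (-(lk m n k : ℝ)) := by
        rw [← Real.rpow_intCast]; push_cast; rfl
      have e2 : -(lk m n k : ℝ) ≤ sig m n * (-(k : ℝ)) + 1 := by
        have := Nat.lt_floor_add_one (sig m n * k)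
        unfold lk; linarith
      have e3 : (n : ℝ) ≤ (m : ℝ) ^ (n : ℝ) := by
        rw [Real.rpow_natCast]
        exact_mod_cast (Nat.lt_pow_self (by omega : 1 < m)).le
      rw [e1]
      calc _ ≤ (n : ℝ) ^ (sig m n * (-(k : ℝ)) + 1) :=
            Real.rpow_le_rpow_of_exponent_le hn1.le e2
        _ = (m : ℝ) ^ (-(k : ℝ)) * n := by
            rw [Real.rpow_add (by linarith), ndiff m n hm hmn, Real.rpow_one]
        _ ≤ (m : ℝ) ^ (-(k : ℝ)) * (m : ℝ) ^ (n : ℝ) := by gcongr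
        _ = _ := by rw [← Real.rpow_add (by linarith)]
    have e1 : (m : ℝ) ^ (-(k : ℤ)) = (m : ℝ) ^ (-(k : ℝ)) := by
      rw [← Real.rpow_intCast]; push_cast; rfl
    have x1 := le_xB n hn (colS i) hc (lk m n k)
    have x2 := xB_le n hn (colS i) hc (lk m n k)
    have y1 := le_xB m hm (rowS i) hr k
    have y2 := xB_le m hm (rowS i) hr k
    have z1 : sB n (colS i) (lk m n k) ≤ z.1 := hz.1.1
    have z2 : z.1 ≤ uB n (colS i) (lk m n k) := hz.1.2
    have z3 : sB m (rowS i) k ≤ z.2 := hz.2.1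
    have z4 : z.2 ≤ uB m (rowS i) k := hz.2.2
    unfold uB at x2 y2 z2 z4
    have d1 : dist z.1 (xB n (colS i)) < r := by
      rw [Real.dist_eq, abs_lt]; constructor <;> linarith
    have d2 : dist z.2 (xB m (rowS i)) < r := by
      rw [Real.dist_eq, abs_lt]; constructor <;> linarith
    rw [mem_ball, Prod.dist_eq]
    exact max_lt d1 d2
  · -- outer inclusion
    intro ε hε
    have r1 := run_lemma _ ε hε (freq_lt D P hP hP1 (fun d => d.1 = 0) (hne1 _))
      (fun r => (i r).1.1 = 0) h3
    have r2 := run_lemma _ ε hε (freq_lt D P hP hP1 (fun d => d.1 = m - 1) (hne1 _))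
      (fun r => (i r).1.1 = m - 1) h4
    have r3 := hlk'.eventually (run_lemma _ ε hε (freq_lt D P hP hP1 (fun d => d.2 = 0) (hne2 _))
      (fun r => (i r).1.2 = 0) h5)
    have r4 := hlk'.eventually (run_lemma _ ε hε
      (freq_lt D P hP hP1 (fun d => d.2 = n - 1) (hne2 _)) (fun r => (i r).1.2 = n - 1) h6)
    filter_upwards [r1, r2, r3, r4] with k r1 r2 r3 r4 z hz
    obtain ⟨a, a1, a2, a3⟩ := r1
    obtain ⟨b, b1, b2, b3⟩ := r2
    obtain ⟨c, c1, c2, c3⟩ := r3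
    obtain ⟨d, d1, d2, d3⟩ := r4
    have y1 := xB_lower m hm (rowS i) hr _ _ a a1 a2 a3
    have y2 := xB_upper m hm (rowS i) hr _ _ b b1 b2 b3
    have x1 := xB_lower n hn (colS i) hc _ _ c c1 c2 c3
    have x2 := xB_upper n hn (colS i) hc _ _ d d1 d2 d3
    have k1 : (m : ℝ) ^ (-((k : ℝ) * (1 + ε))) ≤ (m : ℝ) ^ (-((k + ⌊ε * k⌋₊ : ℕ) : ℤ)) := by
      rw [← Real.rpow_intCast]
      refine Real.rpow_le_rpow_of_exponent_le hm1.le ?_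
      have := Nat.floor_le (show 0 ≤ ε * k by positivity)
      push_cast; linarith
    have k2 : (m : ℝ) ^ (-((k : ℝ) * (1 + ε))) ≤
        (n : ℝ) ^ (-((lk m n k + ⌊ε * lk m n k⌋₊ : ℕ) : ℤ)) := by
      rw [← Real.rpow_intCast, ← ndiff m n hm hmn]
      refine Real.rpow_le_rpow_of_exponent_le hn1.le ?_
      have h1 := Nat.floor_le (show 0 ≤ ε * lk m n k by positivity)
      have h2 : (lk m n k : ℝ) ≤ sig m n * k := Nat.floor_le (by positivity)
      push_cast
      nlinarith
    rw [mem_ball, Prod.dist_eq] at hz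
    have w1 : dist z.1 (xB n (colS i)) < _ := (le_max_left _ _).trans_lt hz
    have w2 : dist z.2 (xB m (rowS i)) < _ := (le_max_right _ _).trans_lt hz
    rw [Real.dist_eq, abs_lt] at w1 w2
    refine ⟨⟨?_, ?_⟩, ⟨?_, ?_⟩⟩
    · change sB n (colS i) (lk m n k) ≤ z.1
      linarith [w1.1]
    · change z.1 ≤ uB n (colS i) (lk m n k)
      linarith [w1.2]
    · change sB m (rowS i) k ≤ z.2
      linarith [w2.1]
    · change z.2 ≤ uB m (rowS i) k
      linarith [w2.2]

end BedfordMcMullen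
end

section
/- Let 𝐢 ∈ Σ, let x = Π(𝐢), and let k ∈ ℕ be such that Z_k(𝐢) < ∞, where Z_k(𝐢) = max{ min{η ≥ 1 : row(i_{k+η}) ≠ row(i_{k+1})}, σ^{−1} min{η ≥ 1 : col(i_{l(k)+η}) ≠ col(i_{l(k)+1})} }. Then μ(B(x, D₁ m^{−k})) ≥ μ(R_k(𝐢)) ≥ μ(B(x, m^{−k−Z_k(𝐢)})), where D₁ = √(n²+1). -/
open MeasureTheory Metric Real Set Filter
open scoped ENNReal Topology

noncomputable section BedfordMcMullen

lemma zpow_conv (b r : ℕ) : (b : ℝ) ^ (-(r + 1 : ℤ)) = ((b : ℝ)⁻¹) ^ (r + 1) := by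
  rw [zpow_neg, inv_pow]
  norm_cast

lemma geo_hasSum (b : ℕ) (hb : 2 ≤ b) :
    HasSum (fun r : ℕ => ((b : ℝ) - 1) * ((b : ℝ)⁻¹) ^ (r + 1)) 1 := by
  have hb' : (2 : ℝ) ≤ b := by exact_mod_cast hb
  have h := hasSum_geometric_of_lt_one (r := (b : ℝ)⁻¹) (by positivity)
    (inv_lt_one_of_one_lt₀ (by linarith))
  have h2 := h.mul_left (((b : ℝ) - 1) * (b : ℝ)⁻¹)
  have h1 : ((b : ℝ) - 1) ≠ 0 := by linarith
  have h0 : (b : ℝ) ≠ 0 := by linarith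
  have h3 : (fun r : ℕ => ((b : ℝ) - 1) * ((b : ℝ)⁻¹) ^ (r + 1)) =
      fun r : ℕ => ((b : ℝ) - 1) * (b : ℝ)⁻¹ * ((b : ℝ)⁻¹) ^ r := by
    funext r; ring
  have h4 : ((b : ℝ) - 1) * (b : ℝ)⁻¹ * (1 - (b : ℝ)⁻¹)⁻¹ = 1 := by
    have : 1 - (b : ℝ)⁻¹ = ((b : ℝ) - 1) * (b : ℝ)⁻¹ := by field_simp
    rw [this, mul_inv_cancel₀]
    exact mul_ne_zero h1 (inv_ne_zero h0)
  rw [h4] at h2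
  rw [h3]
  exact h2

lemma geo_partial (b : ℕ) (hb : 2 ≤ b) (k : ℕ) :
    ∑ r ∈ Finset.range k, ((b : ℝ) - 1) * ((b : ℝ)⁻¹) ^ (r + 1) = 1 - ((b : ℝ)⁻¹) ^ k := by
  have h0 : (b : ℝ) ≠ 0 := by positivity
  induction k with
  | zero => simp
  | succ k ih =>
    rw [Finset.sum_range_succ, ih]
    have : (b : ℝ) * (b : ℝ)⁻¹ = 1 := mul_inv_cancel₀ h0
    rw [pow_succ]
    linear_combination ((b : ℝ)⁻¹) ^ k * this

lemma dig_summable (b : ℕ) (hb : 2 ≤ b) (a : ℕ → ℝ) (h0 : ∀ r, 0 ≤ a r)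
    (h1 : ∀ r, a r ≤ (b : ℝ) - 1) :
    Summable (fun r : ℕ => a r * ((b : ℝ)⁻¹) ^ (r + 1)) :=
  Summable.of_nonneg_of_le (fun r => mul_nonneg (h0 r) (by positivity))
    (fun r => mul_le_mul_of_nonneg_right (h1 r) (by positivity)) (geo_hasSum b hb).summable

lemma dig_lower (b : ℕ) (hb : 2 ≤ b) (a : ℕ → ℝ) (h0 : ∀ r, 0 ≤ a r)
    (h1 : ∀ r, a r ≤ (b : ℝ) - 1) (k : ℕ) :
    ∑ r ∈ Finset.range k, a r * ((b : ℝ)⁻¹) ^ (r + 1) ≤ ∑' r, a r * ((b : ℝ)⁻¹) ^ (r + 1) :=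
  (dig_summable b hb a h0 h1).sum_le_tsum _ (fun r _ => mul_nonneg (h0 r) (by positivity))

lemma dig_lower' (b : ℕ) (hb : 2 ≤ b) (a : ℕ → ℝ) (h0 : ∀ r, 0 ≤ a r)
    (h1 : ∀ r, a r ≤ (b : ℝ) - 1) (k s N : ℕ) (hks : k ≤ s) (hsN : s + 1 ≤ N) (hs : 1 ≤ a s) :
    ∑ r ∈ Finset.range k, a r * ((b : ℝ)⁻¹) ^ (r + 1) + ((b : ℝ)⁻¹) ^ N
      ≤ ∑' r, a r * ((b : ℝ)⁻¹) ^ (r + 1) := by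
  have hb' : (2 : ℝ) ≤ b := by exact_mod_cast hb
  refine le_trans ?_ (dig_lower b hb a h0 h1 (s + 1))
  rw [Finset.sum_range_succ]
  refine add_le_add ?_ ?_
  · exact Finset.sum_le_sum_of_subset_of_nonneg (Finset.range_mono hks)
      (fun r _ _ => mul_nonneg (h0 r) (by positivity))
  · calc ((b : ℝ)⁻¹) ^ N ≤ ((b : ℝ)⁻¹) ^ (s + 1) :=
          pow_le_pow_of_le_one (by positivity) (inv_le_one_of_one_le₀ (by linarith)) hsN
      _ = 1 * ((b : ℝ)⁻¹) ^ (s + 1) := (one_mul _).symm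
      _ ≤ _ := mul_le_mul_of_nonneg_right hs (by positivity)

lemma refl_tsum (b : ℕ) (hb : 2 ≤ b) (a : ℕ → ℝ) (h0 : ∀ r, 0 ≤ a r)
    (h1 : ∀ r, a r ≤ (b : ℝ) - 1) :
    ∑' r, ((b : ℝ) - 1 - a r) * ((b : ℝ)⁻¹) ^ (r + 1)
      = 1 - ∑' r, a r * ((b : ℝ)⁻¹) ^ (r + 1) := by
  have h := (geo_hasSum b hb).sub (dig_summable b hb a h0 h1).hasSum
  rw [← h.tsum_eq]
  congr 1; ext r; ring

lemma refl_sum (b : ℕ) (hb : 2 ≤ b) (a : ℕ → ℝ) (k : ℕ) :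
    ∑ r ∈ Finset.range k, ((b : ℝ) - 1 - a r) * ((b : ℝ)⁻¹) ^ (r + 1)
      = 1 - ((b : ℝ)⁻¹) ^ k - ∑ r ∈ Finset.range k, a r * ((b : ℝ)⁻¹) ^ (r + 1) := by
  rw [← geo_partial b hb k, ← Finset.sum_sub_distrib]
  congr 1; ext r; ring

lemma dig_mem (b : ℕ) (hb : 2 ≤ b) (a : ℕ → ℕ) (h : ∀ r, a r < b) (k : ℕ) :
    ∑' r : ℕ, (a r : ℝ) * (b : ℝ) ^ (-(r + 1 : ℤ)) ∈
      Icc (∑ r ∈ Finset.range k, (a r : ℝ) * (b : ℝ) ^ (-(r + 1 : ℤ)))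
       (∑ r ∈ Finset.range k, (a r : ℝ) * (b : ℝ) ^ (-(r + 1 : ℤ)) + (b : ℝ) ^ (-(k : ℤ))) := by
  simp only [zpow_conv]
  rw [zpow_neg, zpow_natCast, ← inv_pow]
  have h0 : ∀ r, (0 : ℝ) ≤ a r := fun r => Nat.cast_nonneg _
  have h1 : ∀ r, (a r : ℝ) ≤ (b : ℝ) - 1 := fun r => by
    have : ((a r + 1 : ℕ) : ℝ) ≤ b := by exact_mod_cast h r
    push_cast at this; linarith
  refine ⟨dig_lower b hb _ h0 h1 k, ?_⟩
  have := dig_lower b hb (fun r => (b : ℝ) - 1 - a r) (fun r => by linarith [h1 r])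
    (fun r => by linarith [h0 r]) k
  rw [refl_tsum b hb _ h0 h1, refl_sum b hb] at this
  linarith

lemma dig_ball (b : ℕ) (hb : 2 ≤ b) (a : ℕ → ℕ) (h : ∀ r, a r < b) (k η : ℕ) (hη : 1 ≤ η)
    (hne : a (k + η - 1) ≠ a k) :
    ball (∑' r : ℕ, (a r : ℝ) * (b : ℝ) ^ (-(r + 1 : ℤ))) (((b : ℝ)⁻¹) ^ (k + η)) ⊆
      Icc (∑ r ∈ Finset.range k, (a r : ℝ) * (b : ℝ) ^ (-(r + 1 : ℤ)))
       (∑ r ∈ Finset.range k, (a r : ℝ) * (b : ℝ) ^ (-(r + 1 : ℤ)) + (b : ℝ) ^ (-(k : ℤ))) := by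
  simp only [zpow_conv]
  rw [zpow_neg, zpow_natCast, ← inv_pow]
  have h0 : ∀ r, (0 : ℝ) ≤ a r := fun r => Nat.cast_nonneg _
  have h1 : ∀ r, (a r : ℝ) ≤ (b : ℝ) - 1 := fun r => by
    have : ((a r + 1 : ℕ) : ℝ) ≤ b := by exact_mod_cast h r
    push_cast at this; linarith
  have L : ∃ s, k ≤ s ∧ s + 1 ≤ k + η ∧ 1 ≤ a s := by
    by_cases hk : 1 ≤ a k
    · exact ⟨k, le_rfl, by omega, hk⟩
    · exact ⟨k + η - 1, by omega, by omega, by omega⟩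
  have U : ∃ s, k ≤ s ∧ s + 1 ≤ k + η ∧ a s + 2 ≤ b := by
    have := h k
    have := h (k + η - 1)
    by_cases hk : a k + 2 ≤ b
    · exact ⟨k, le_rfl, by omega, hk⟩
    · exact ⟨k + η - 1, by omega, by omega, by omega⟩
  obtain ⟨s, hs1, hs2, hs3⟩ := L
  obtain ⟨t, ht1, ht2, ht3⟩ := U
  have lo := dig_lower' b hb (fun r => (a r : ℝ)) h0 h1 k s (k + η) hs1 hs2 (by exact_mod_cast hs3)
  have up := dig_lower' b hb (fun r => (b : ℝ) - 1 - a r) (fun r => by linarith [h1 r])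
    (fun r => by linarith [h0 r]) k t (k + η) ht1 ht2 (by
      have : ((a t + 2 : ℕ) : ℝ) ≤ b := by exact_mod_cast ht3
      push_cast at this; linarith)
  rw [refl_tsum b hb _ h0 h1, refl_sum b hb] at up
  intro z hz
  rw [Metric.mem_ball, Real.dist_eq, abs_lt] at hz
  constructor <;> linarith [hz.1, hz.2]

lemma exists_of_iInf (S : Set ℕ) (h : (⨅ η ∈ S, (η : ℝ≥0∞)) ≠ ⊤) :
    ∃ η ∈ S, (η : ℝ≥0∞) ≤ ⨅ η ∈ S, (η : ℝ≥0∞) := by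
  have hS : S.Nonempty := by
    by_contra hS
    rw [Set.not_nonempty_iff_eq_empty] at hS
    subst hS
    simp at h
  refine ⟨sInf S, Nat.sInf_mem hS, le_iInf₂ fun η hη => ?_⟩
  exact_mod_cast Nat.sInf_le hη

theorem ball_approxSq_ball
    (m n : ℕ) (hm : 2 ≤ m) (hmn : m < n)
    (D : Finset (ℕ × ℕ)) (hD : ∀ d ∈ D, d.1 < m ∧ d.2 < n)
    (hrow : ∃ d ∈ D, ∃ d' ∈ D, d.1 ≠ d'.1)
    (hcol : ∃ d ∈ D, ∃ d' ∈ D, d.2 ≠ d'.2)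
    (p : ℕ × ℕ → ℝ) (hp : ∀ d ∈ D, 0 < p d) (hp1 : ∑ d ∈ D, p d = 1)
    (μ : Measure (ℝ × ℝ)) (hμ1 : IsProbabilityMeasure μ) (hμ : IsSelfAffine m n D p μ)
    (Λ : Set (ℝ × ℝ)) (hΛ : IsAttractor m n D Λ)
 :
    ∀ (i : Word D) (k : ℕ), Zk m n i k ≠ ⊤ →
      μ (ball (proj m n i) ((m : ℝ) ^ (-(k : ℝ) - (Zk m n i k).toReal))) ≤
          μ (approxSq m n k i) ∧
        μ (approxSq m n k i) ≤ μ (ball (proj m n i) (D1 n * (m : ℝ) ^ (-(k : ℝ)))) := by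
  intro i k hZ
  have hn : 2 ≤ n := by omega
  have hm' : (2 : ℝ) ≤ m := by exact_mod_cast hm
  have hn' : (2 : ℝ) ≤ n := by exact_mod_cast hn
  have hm0 : (0 : ℝ) < m := by linarith
  have hn0 : (0 : ℝ) < n := by linarith
  have hlm : 0 < Real.log m := Real.log_pos (by linarith)
  have hln : 0 < Real.log n := Real.log_pos (by linarith)
  have hσ : 0 < sig m n := div_pos hlm hln
  have hσn : sig m n * Real.log n = Real.log m := div_mul_cancel₀ _ hln.ne'
  have hra : ∀ r, (i r).1.1 < m := fun r => (hD _ (i r).2).1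
  have hca : ∀ r, (i r).1.2 < n := fun r => (hD _ (i r).2).2
  have hmn_pow : ∀ t : ℝ, (m : ℝ) ^ t = (n : ℝ) ^ (sig m n * t) := fun t => by
    rw [Real.rpow_def_of_pos hm0, Real.rpow_def_of_pos hn0, ← hσn]
    ring_nf
  have hl1 : (lk m n k : ℝ) ≤ sig m n * k := Nat.floor_le (by positivity)
  have hl2 : sig m n * k < lk m n k + 1 := Nat.lt_floor_add_one _
  constructor
  · apply measure_mono
    have hZ1 : (⨅ η ∈ {η : ℕ | 1 ≤ η ∧ (i (k + η - 1)).1.1 ≠ (i k).1.1}, (η : ℝ≥0∞)) ≠ ⊤ :=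
      ne_top_of_le_ne_top hZ (le_max_left _ _)
    have hZ2' : ENNReal.ofReal (sig m n)⁻¹ *
      (⨅ η ∈ {η : ℕ | 1 ≤ η ∧ (i (lk m n k + η - 1)).1.2 ≠ (i (lk m n k)).1.2}, (η : ℝ≥0∞)) ≠ ⊤ :=
      ne_top_of_le_ne_top hZ (le_max_right _ _)
    have hpos : ENNReal.ofReal (sig m n)⁻¹ ≠ 0 := by
      simpa using hσ
    have hZ2 : (⨅ η ∈ {η : ℕ | 1 ≤ η ∧ (i (lk m n k + η - 1)).1.2 ≠ (i (lk m n k)).1.2},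
        (η : ℝ≥0∞)) ≠ ⊤ := by
      intro h
      rw [h] at hZ2'
      exact hZ2' (ENNReal.mul_top hpos)
    obtain ⟨η, ⟨hη1, hη2⟩, hη⟩ := exists_of_iInf _ hZ1
    obtain ⟨θ, ⟨hθ1, hθ2⟩, hθ⟩ := exists_of_iInf _ hZ2
    have hηZ : (η : ℝ) ≤ (Zk m n i k).toReal := by
      have := ENNReal.toReal_mono hZ (hη.trans (le_max_left _ _))
      simpa using this
    have hθZ : (sig m n)⁻¹ * (θ : ℝ) ≤ (Zk m n i k).toReal := by
      have := ENNReal.toReal_mono hZ ((mul_le_mul_right hθ _).trans (le_max_right _ _))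
      simpa [ENNReal.toReal_mul, ENNReal.toReal_ofReal (inv_nonneg.2 hσ.le)] using this
    have hθZ' : (θ : ℝ) ≤ sig m n * (Zk m n i k).toReal := by
      rwa [inv_mul_le_iff₀ hσ] at hθZ
    generalize (Zk m n i k).toReal = Z at *
    have r1 : (m : ℝ) ^ (-(k : ℝ) - Z) ≤ ((m : ℝ)⁻¹) ^ (k + η) := by
      rw [inv_pow, ← Real.rpow_natCast, ← Real.rpow_neg hm0.le]
      apply Real.rpow_le_rpow_of_exponent_le (by linarith)
      push_cast; linarith
    have r2 : (m : ℝ) ^ (-(k : ℝ) - Z) ≤ ((n : ℝ)⁻¹) ^ (lk m n k + θ) := by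
      rw [inv_pow, ← Real.rpow_natCast, ← Real.rpow_neg hn0.le, hmn_pow]
      apply Real.rpow_le_rpow_of_exponent_le (by linarith)
      push_cast; linarith
    rintro ⟨u, v⟩ huv
    rw [Metric.mem_ball, Prod.dist_eq, max_lt_iff] at huv
    refine ⟨?_, ?_⟩
    · exact dig_ball n hn (fun r => (i r).1.2) hca (lk m n k) θ hθ1 hθ2
        (Metric.mem_ball.2 (huv.1.trans_le r2))
    · exact dig_ball m hm (fun r => (i r).1.1) hra k η hη1 hη2
        (Metric.mem_ball.2 (huv.2.trans_le r1))
  · apply measure_mono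
    have hnD : (n : ℝ) < D1 n := Real.lt_sqrt_of_sq_lt (by linarith)
    have hmk : 0 < (m : ℝ) ^ (-(k : ℝ)) := Real.rpow_pos_of_pos hm0 _
    have e1 : (n : ℝ) ^ (-(lk m n k : ℤ)) < D1 n * (m : ℝ) ^ (-(k : ℝ)) := by
      refine lt_of_le_of_lt ?_ (mul_lt_mul_of_pos_right hnD hmk)
      rw [hmn_pow]
      nth_rewrite 2 [← Real.rpow_one (n : ℝ)]
      rw [← Real.rpow_add hn0, ← Real.rpow_intCast]
      apply Real.rpow_le_rpow_of_exponent_le (by linarith)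
      push_cast; linarith
    have e2 : (m : ℝ) ^ (-(k : ℤ)) < D1 n * (m : ℝ) ^ (-(k : ℝ)) := by
      have : (m : ℝ) ^ (-(k : ℤ)) = (m : ℝ) ^ (-(k : ℝ)) := by
        rw [← Real.rpow_intCast]; push_cast; rfl
      rw [this]
      nlinarith
    rintro ⟨u, v⟩ ⟨hu, hv⟩
    have x1 := dig_mem n hn (fun r => (i r).1.2) hca (lk m n k)
    have x2 := dig_mem m hm (fun r => (i r).1.1) hra k
    rw [Metric.mem_ball, Prod.dist_eq, max_lt_iff]
    refine ⟨lt_of_le_of_lt (Real.dist_le_of_mem_Icc hu x1) ?_,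
      lt_of_le_of_lt (Real.dist_le_of_mem_Icc hv x2) ?_⟩
    · simpa using e1
    · simpa using e2

end BedfordMcMullen
end

section
/- Let α ∈ ℝ, ε > 0, and x ∈ X_α. Then there exists K ∈ ℕ such that for every k ≥ K there exists 𝐢 ∈ Σ with: (1) the distance from x to R_k(𝐢) is at most D₁ m^{−k}/2, and (2) R_k(𝐢) ∈ Y(α,ε,k), i.e. m^{−kα(1+ε)} ≤ μ(R_k(𝐢)) ≤ m^{−kα(1−ε)}. -/
open MeasureTheory Metric Real Set Filter
open scoped ENNReal Topology

noncomputable section BedfordMcMullen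

/-! ### One-dimensional digit expansions -/

/-- Partial digit expansion. -/
def digS (b : ℕ) (u : ℕ → ℕ) (k : ℕ) : ℝ :=
  ∑ r ∈ Finset.range k, (u r : ℝ) * (b : ℝ) ^ (-(r + 1 : ℤ))

/-- Prepend an element to a sequence. -/
def consSeq {A : Type*} (a : A) (u : ℕ → A) : ℕ → A
  | 0 => a
  | r + 1 => u r

lemma digS_succ (b : ℕ) (u : ℕ → ℕ) (k : ℕ) :
    digS b u (k + 1) = digS b u k + (u k : ℝ) * (b : ℝ) ^ (-(k + 1 : ℤ)) := by
  simp [digS, Finset.sum_range_succ]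

lemma digS_cons (b : ℕ) (hb : 0 < b) (a : ℕ) (u : ℕ → ℕ) (k : ℕ) :
    digS b (consSeq a u) (k + 1) = (digS b u k + a) / b := by
  have hb' : (b : ℝ) ≠ 0 := by positivity
  induction k with
  | zero => simp [digS, consSeq]; field_simp
  | succ k ih =>
    rw [digS_succ, ih, digS_succ b u k]
    have : (b : ℝ) ^ (-(((k + 1 : ℕ) : ℤ) + 1)) = (b : ℝ) ^ (-((k : ℤ) + 1)) / b := by
      rw [show (-(((k + 1 : ℕ) : ℤ) + 1)) = (-((k : ℤ) + 1)) - 1 by push_cast; ring,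
        zpow_sub_one₀ hb']
      rfl
    rw [this]
    simp only [consSeq]
    ring

lemma zpow_neg_succ_eq (b : ℕ) (hb : 0 < b) (k : ℕ) :
    (b : ℝ) ^ (-(k : ℤ)) = b * (b : ℝ) ^ (-((k : ℤ) + 1)) := by
  have hb' : (b : ℝ) ≠ 0 := by positivity
  rw [show (-(k : ℤ)) = (-((k : ℤ) + 1)) + 1 by ring, zpow_add_one₀ hb']
  ring_nf

lemma digS_nested (b : ℕ) (hb : 0 < b) (u : ℕ → ℕ) (hu : ∀ r, u r < b) (l k : ℕ) (h : l ≤ k) :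
    digS b u l ≤ digS b u k ∧
      digS b u k + (b : ℝ) ^ (-(k : ℤ)) ≤ digS b u l + (b : ℝ) ^ (-(l : ℤ)) := by
  induction k, h using Nat.le_induction with
  | base => simp
  | succ k _ ih =>
    rw [digS_succ]
    have h1 : (0 : ℝ) < (b : ℝ) ^ (-((k : ℤ) + 1)) := by positivity
    have h2 := zpow_neg_succ_eq b hb k
    have h3 : (u k : ℝ) + 1 ≤ b := by exact_mod_cast hu k
    have h4 : (0 : ℝ) ≤ u k := by positivity
    push_cast
    constructor
    · nlinarith [ih.1]
    · nlinarith [ih.2]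

lemma digS_int (b : ℕ) (hb : 0 < b) (u : ℕ → ℕ) (k : ℕ) :
    ∃ a : ℤ, digS b u k = a * (b : ℝ) ^ (-(k : ℤ)) := by
  induction k with
  | zero => exact ⟨0, by simp [digS]⟩
  | succ k ih =>
    obtain ⟨a, ha⟩ := ih
    refine ⟨a * b + u k, ?_⟩
    rw [digS_succ, ha, zpow_neg_succ_eq b hb k]
    push_cast
    ring

/-! ### The exponents -/

lemma lk_bounds (m n : ℕ) (hm : 2 ≤ m) (hmn : m < n) (k : ℕ) :
    lk m n k ≤ k ∧ (m : ℝ) ^ (-(k : ℤ)) ≤ (n : ℝ) ^ (-(lk m n k : ℤ)) ∧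
      (n : ℝ) ^ (-(lk m n k : ℤ)) ≤ n * (m : ℝ) ^ (-(k : ℤ)) := by
  have hm1 : (1 : ℝ) < m := by exact_mod_cast (by omega : 1 < m)
  have hn1 : (1 : ℝ) < n := by exact_mod_cast (by omega : 1 < n)
  have hmn' : (m : ℝ) < n := by exact_mod_cast hmn
  have lm : 0 < Real.log m := Real.log_pos hm1
  have ln : 0 < Real.log n := Real.log_pos hn1
  have lmn : Real.log m < Real.log n := Real.log_lt_log (by linarith) hmn'
  have hs0 : 0 < sig m n := div_pos lm ln
  have hs1 : sig m n < 1 := (div_lt_one ln).2 lmn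
  have hsl : sig m n * Real.log n = Real.log m := div_mul_cancel₀ _ ln.ne'
  have f1 : (lk m n k : ℝ) ≤ sig m n * k := Nat.floor_le (by positivity)
  have f2 : sig m n * k < lk m n k + 1 := Nat.lt_floor_add_one _
  have e1 : (n : ℝ) ^ (lk m n k) ≤ (m : ℝ) ^ k := by
    rw [← Real.log_le_log_iff (by positivity) (by positivity), Real.log_pow, Real.log_pow, ← hsl]
    nlinarith
  have e2 : (m : ℝ) ^ k ≤ (n : ℝ) ^ (lk m n k) * n := by
    rw [← pow_succ, ← Real.log_le_log_iff (by positivity) (by positivity), Real.log_pow,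
      Real.log_pow, ← hsl]
    push_cast
    nlinarith
  refine ⟨?_, ?_, ?_⟩
  · have : (lk m n k : ℝ) ≤ k := by
      have : (0 : ℝ) ≤ k := by positivity
      nlinarith
    exact_mod_cast this
  · rw [zpow_neg, zpow_neg, zpow_natCast, zpow_natCast]
    exact inv_anti₀ (by positivity) e1
  · rw [zpow_neg, zpow_neg, zpow_natCast, zpow_natCast, ← div_eq_mul_inv,
      inv_eq_one_div, div_le_div_iff₀ (by positivity) (by positivity)]
    linarith

/-! ### The measure: basics -/

lemma Tmap_continuous (m n : ℕ) (d : ℕ × ℕ) : Continuous (Tmap m n d) := by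
  unfold Tmap; fun_prop

lemma real_selfAffine {m n : ℕ} {D : Finset (ℕ × ℕ)} {p : ℕ × ℕ → ℝ} (hp : ∀ d ∈ D, 0 < p d)
    {μ : Measure (ℝ × ℝ)} (hμ1 : IsProbabilityMeasure μ) (hμ : IsSelfAffine m n D p μ)
    (A : Set (ℝ × ℝ)) (hA : MeasurableSet A) :
    μ.real A = ∑ d ∈ D, p d * μ.real (Tmap m n d ⁻¹' A) := by
  rw [measureReal_def, hμ A hA, ENNReal.toReal_sum]
  · refine Finset.sum_congr rfl fun d hd => ?_
    rw [ENNReal.toReal_mul, ENNReal.toReal_ofReal (hp d hd).le, measureReal_def]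
  · intro d _
    exact ENNReal.mul_ne_top ENNReal.ofReal_ne_top (measure_ne_top _ _)

/-- Enlarged unit square. -/
def boxR (R : ℝ) : Set (ℝ × ℝ) := Icc (-R) (1 + R) ×ˢ Icc (-R) (1 + R)

lemma measurableSet_boxR (R : ℝ) : MeasurableSet (boxR R) := measurableSet_Icc.prod measurableSet_Icc

lemma aff_mem {b : ℕ} (hb : 2 ≤ b) {m : ℕ} (hm : 2 ≤ m) (hmb : m ≤ b) {a : ℕ} (ha : a < b)
    {R t : ℝ} (hR : 0 ≤ R) (ht : t ∈ Icc (-R) (1 + R)) :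
    (t + a) / b ∈ Icc (-(R / m)) (1 + R / m) := by
  have hb0 : (0 : ℝ) < b := by positivity
  have hm0 : (0 : ℝ) < m := by positivity
  have hmb' : (m : ℝ) ≤ b := by exact_mod_cast hmb
  have ha' : (a : ℝ) + 1 ≤ b := by exact_mod_cast ha
  have ha0 : (0 : ℝ) ≤ a := by positivity
  have h1 : R / b ≤ R / m := div_le_div_of_nonneg_left hR hm0 hmb'
  have h2 : R / b * b = R := div_mul_cancel₀ _ hb0.ne'
  obtain ⟨t1, t2⟩ := ht
  constructor
  · refine le_trans (neg_le_neg h1) ?_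
    rw [le_div_iff₀ hb0]; nlinarith
  · refine le_trans ?_ (add_le_add_right h1 1)
    rw [div_le_iff₀ hb0]; nlinarith

lemma Tmap_box {m n : ℕ} (hm : 2 ≤ m) (hmn : m < n) {d : ℕ × ℕ} (hd : d.1 < m ∧ d.2 < n) {R : ℝ}
    (hR : 0 ≤ R) : boxR R ⊆ Tmap m n d ⁻¹' boxR (R / m) := by
  rintro ⟨a, b⟩ ⟨h1, h2⟩
  exact ⟨aff_mem (by omega) hm hmn.le hd.2 hR h1, aff_mem hm hm le_rfl hd.1 hR h2⟩

lemma box_mono_step {m n : ℕ} (hm : 2 ≤ m) (hmn : m < n)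
    {D : Finset (ℕ × ℕ)} (hD : ∀ d ∈ D, d.1 < m ∧ d.2 < n)
    {p : ℕ × ℕ → ℝ} (hp : ∀ d ∈ D, 0 < p d) (hp1 : ∑ d ∈ D, p d = 1)
    {μ : Measure (ℝ × ℝ)} (hμ1 : IsProbabilityMeasure μ) (hμ : IsSelfAffine m n D p μ)
    {R : ℝ} (hR : 0 ≤ R) (k : ℕ) : μ.real (boxR R) ≤ μ.real (boxR (R / (m : ℝ) ^ k)) := by
  induction k with
  | zero => simp
  | succ k ih =>
    refine ih.trans ?_
    rw [pow_succ, ← div_div, real_selfAffine hp hμ1 hμ _ (measurableSet_boxR (R / (m : ℝ) ^ k / m))]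
    calc μ.real (boxR (R / (m : ℝ) ^ k)) = ∑ d ∈ D, p d * μ.real (boxR (R / (m : ℝ) ^ k)) := by
          rw [← Finset.sum_mul, hp1, one_mul]
      _ ≤ _ := by
          refine Finset.sum_le_sum fun d hd => mul_le_mul_of_nonneg_left ?_ (hp d hd).le
          exact measureReal_mono (Tmap_box hm hmn (hD d hd) (by positivity))

lemma unit_full {m n : ℕ} (hm : 2 ≤ m) (hmn : m < n)
    {D : Finset (ℕ × ℕ)} (hD : ∀ d ∈ D, d.1 < m ∧ d.2 < n)
    {p : ℕ × ℕ → ℝ} (hp : ∀ d ∈ D, 0 < p d) (hp1 : ∑ d ∈ D, p d = 1)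
    {μ : Measure (ℝ × ℝ)} (hμ1 : IsProbabilityMeasure μ) (hμ : IsSelfAffine m n D p μ) :
    μ.real (boxR 0) = 1 := by
  have hm1 : (1 : ℝ) < m := by exact_mod_cast (by omega : 1 < m)
  -- boxes of every positive size are full
  have hfull : ∀ δ > 0, μ.real (boxR δ) = 1 := by
    intro δ hδ
    have hmono : Monotone fun N : ℕ => boxR (N : ℝ) := by
      intro a b hab
      have : (a : ℝ) ≤ b := by exact_mod_cast hab
      exact prod_mono (Icc_subset_Icc (by linarith) (by linarith))
        (Icc_subset_Icc (by linarith) (by linarith))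
    have hun : (⋃ N : ℕ, boxR (N : ℝ)) = univ := by
      refine eq_univ_of_forall fun z => ?_
      obtain ⟨N, hN⟩ := exists_nat_ge (max |z.1| |z.2|)
      have h1 := abs_le.1 ((le_max_left _ _).trans hN)
      have h2 := abs_le.1 ((le_max_right _ _).trans hN)
      exact mem_iUnion.2 ⟨N, ⟨⟨by linarith [h1.1], by linarith [h1.2]⟩,
        ⟨by linarith [h2.1], by linarith [h2.2]⟩⟩⟩
    have ht : Tendsto (fun N : ℕ => μ.real (boxR (N : ℝ))) atTop (𝓝 1) := by
      have := tendsto_measure_iUnion_atTop (μ := μ) hmono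
      rw [hun, measure_univ] at this
      have h2 := (ENNReal.tendsto_toReal ENNReal.one_ne_top).comp this
      simpa [Function.comp_def, measureReal_def] using h2
    refine le_antisymm measureReal_le_one (le_of_tendsto' ht fun N => ?_)
    obtain ⟨k, hk⟩ := pow_unbounded_of_one_lt ((N : ℝ) / δ) hm1
    refine (box_mono_step hm hmn hD hp hp1 hμ1 hμ (Nat.cast_nonneg N) k).trans ?_
    have : (N : ℝ) / (m : ℝ) ^ k ≤ δ := by
      rw [div_le_iff₀ (by positivity)]
      rw [div_lt_iff₀ hδ] at hk
      linarith
    exact measureReal_mono (prod_mono (Icc_subset_Icc (by linarith) (by linarith))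
        (Icc_subset_Icc (by linarith) (by linarith)))
  have hanti : Antitone fun N : ℕ => boxR (1 / ((N : ℝ) + 1)) := by
    intro a b hab
    have : 1 / ((b : ℝ) + 1) ≤ 1 / ((a : ℝ) + 1) := Nat.one_div_le_one_div hab
    exact prod_mono (Icc_subset_Icc (by linarith) (by linarith))
        (Icc_subset_Icc (by linarith) (by linarith))
  have hint : (⋂ N : ℕ, boxR (1 / ((N : ℝ) + 1))) = boxR 0 := by
    have hlim := tendsto_one_div_add_atTop_nhds_zero_nat (𝕜 := ℝ)
    apply Subset.antisymm
    · intro z hz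
      rw [mem_iInter] at hz
      have hl1 : Tendsto (fun N : ℕ => -(1 / ((N : ℝ) + 1))) atTop (𝓝 (-0)) := hlim.neg
      have hl2 : Tendsto (fun N : ℕ => 1 + (1 / ((N : ℝ) + 1))) atTop (𝓝 (1 + 0)) := hlim.const_add 1
      exact ⟨⟨le_of_tendsto' hl1 fun N => (hz N).1.1, ge_of_tendsto' hl2 fun N => (hz N).1.2⟩,
        ⟨le_of_tendsto' hl1 fun N => (hz N).2.1, ge_of_tendsto' hl2 fun N => (hz N).2.2⟩⟩
    · refine subset_iInter fun N => ?_
      have : (0 : ℝ) ≤ 1 / ((N : ℝ) + 1) := by positivity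
      exact prod_mono (Icc_subset_Icc (by linarith) (by linarith))
        (Icc_subset_Icc (by linarith) (by linarith))
  have ht := tendsto_measure_iInter_atTop (μ := μ)
    (fun N : ℕ => (measurableSet_boxR (1 / ((N : ℝ) + 1))).nullMeasurableSet) hanti
    ⟨0, measure_ne_top _ _⟩
  rw [hint] at ht
  have h2 := (ENNReal.tendsto_toReal (measure_ne_top μ (boxR 0))).comp ht
  have h3 : Tendsto (fun _ : ℕ => (1 : ℝ)) atTop (𝓝 (μ.real (boxR 0))) := by
    refine h2.congr fun N => ?_
    exact hfull _ (by positivity)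
  exact tendsto_nhds_unique h3 tendsto_const_nhds |>.symm ▸ rfl

/-! ### Level sets of the construction -/

/-- Level-`k` approximation of the carpet. -/
def levS (m n : ℕ) (D : Finset (ℕ × ℕ)) : ℕ → Set (ℝ × ℝ)
  | 0 => boxR 0
  | k + 1 => ⋃ d ∈ D, Tmap m n d '' levS m n D k

lemma levS_compact (m n : ℕ) (D : Finset (ℕ × ℕ)) (k : ℕ) : IsCompact (levS m n D k) := by
  induction k with
  | zero => exact isCompact_Icc.prod isCompact_Icc
  | succ k ih => exact D.isCompact_biUnion fun d _ => ih.image (Tmap_continuous m n d)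

lemma levS_full {m n : ℕ} (hm : 2 ≤ m) (hmn : m < n)
    {D : Finset (ℕ × ℕ)} (hD : ∀ d ∈ D, d.1 < m ∧ d.2 < n)
    {p : ℕ × ℕ → ℝ} (hp : ∀ d ∈ D, 0 < p d) (hp1 : ∑ d ∈ D, p d = 1)
    {μ : Measure (ℝ × ℝ)} (hμ1 : IsProbabilityMeasure μ) (hμ : IsSelfAffine m n D p μ) (k : ℕ) :
    μ.real (levS m n D k) = 1 := by
  induction k with
  | zero => exact unit_full hm hmn hD hp hp1 hμ1 hμ
  | succ k ih =>
    refine le_antisymm measureReal_le_one ?_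
    rw [real_selfAffine hp hμ1 hμ _ (levS_compact m n D (k + 1)).measurableSet, ← hp1]
    refine Finset.sum_le_sum fun d hd => ?_
    have : μ.real (levS m n D k) ≤ μ.real (Tmap m n d ⁻¹' levS m n D (k + 1)) := by
      refine measureReal_mono fun z hz => ?_
      exact mem_biUnion (show d ∈ (D : Set (ℕ × ℕ)) from hd) (mem_image_of_mem _ hz)
    have := hp d hd
    nlinarith

/-- A rectangle with given corner indices. -/
def gridSq (m n k : ℕ) (a b : ℤ) : Set (ℝ × ℝ) :=
  Icc (a * (n : ℝ) ^ (-(lk m n k : ℤ))) (a * (n : ℝ) ^ (-(lk m n k : ℤ)) + (n : ℝ) ^ (-(lk m n k : ℤ)))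
   ×ˢ Icc (b * (m : ℝ) ^ (-(k : ℤ))) (b * (m : ℝ) ^ (-(k : ℤ)) + (m : ℝ) ^ (-(k : ℤ)))

lemma levS_word {m n : ℕ} (hm : 2 ≤ m) (hmn : m < n) {D : Finset (ℕ × ℕ)} (hne : D.Nonempty)
    (k : ℕ) : ∀ z ∈ levS m n D k, ∃ i : Word D,
      z.1 ∈ Icc (digS n (fun r => (i r).1.2) k) (digS n (fun r => (i r).1.2) k + (n : ℝ) ^ (-(k : ℤ))) ∧
      z.2 ∈ Icc (digS m (fun r => (i r).1.1) k) (digS m (fun r => (i r).1.1) k + (m : ℝ) ^ (-(k : ℤ))) := by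
  have hn0 : 0 < n := by omega
  have hm0 : 0 < m := by omega
  induction k with
  | zero =>
    intro z hz
    obtain ⟨d, hd⟩ := hne
    exact ⟨fun _ => ⟨d, hd⟩, by
      obtain ⟨h1, h2⟩ : z ∈ boxR 0 := hz
      constructor
      · simpa [digS] using h1
      · simpa [digS] using h2⟩
  | succ k ih =>
    intro z hz
    simp only [levS, mem_iUnion] at hz
    obtain ⟨d, hd, y, hy, rfl⟩ := hz
    obtain ⟨i, h1, h2⟩ := ih y hy
    refine ⟨consSeq ⟨d, hd⟩ i, ?_⟩
    have e1 : (fun r => (consSeq (⟨d, hd⟩ : Digit D) i r).1.2) = consSeq d.2 fun r => (i r).1.2 := by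
      funext r; cases r <;> rfl
    have e2 : (fun r => (consSeq (⟨d, hd⟩ : Digit D) i r).1.1) = consSeq d.1 fun r => (i r).1.1 := by
      funext r; cases r <;> rfl
    rw [e1, e2, digS_cons n hn0, digS_cons m hm0]
    have hn' : (0 : ℝ) < n := by positivity
    have hm' : (0 : ℝ) < m := by positivity
    rw [zpow_neg_succ_eq n hn0] at h1
    rw [zpow_neg_succ_eq m hm0] at h2
    simp only [Tmap, mem_Icc] at *
    push_cast
    refine ⟨⟨?_, ?_⟩, ⟨?_, ?_⟩⟩
    · gcongr; exact h1.1
    · rw [div_add' _ _ _ hn'.ne', div_le_div_iff_of_pos_right hn']; linarith [h1.2]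
    · gcongr; exact h2.1
    · rw [div_add' _ _ _ hm'.ne', div_le_div_iff_of_pos_right hm']; linarith [h2.2]

lemma levS_sq {m n : ℕ} (hm : 2 ≤ m) (hmn : m < n) {D : Finset (ℕ × ℕ)} (hne : D.Nonempty)
    (hD : ∀ d ∈ D, d.1 < m ∧ d.2 < n)
    (k : ℕ) (z : ℝ × ℝ) (hz : z ∈ levS m n D k) : ∃ i : Word D, z ∈ approxSq m n k i := by
  obtain ⟨i, h1, h2⟩ := levS_word hm hmn hne k z hz
  refine ⟨i, ?_, h2⟩
  have := digS_nested n (by omega) (fun r => (i r).1.2) (fun r => (hD _ (i r).2).2) _ _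
    (lk_bounds m n hm hmn k).1
  exact ⟨this.1.trans h1.1, h1.2.trans this.2⟩

lemma approxSq_grid {m n : ℕ} (hm : 2 ≤ m) (hmn : m < n) {D : Finset (ℕ × ℕ)} (k : ℕ)
    (i : Word D) : ∃ a b : ℤ, approxSq m n k i = gridSq m n k a b := by
  obtain ⟨a, ha⟩ := digS_int n (by omega) (fun r => (i r).1.2) (lk m n k)
  obtain ⟨b, hb⟩ := digS_int m (by omega) (fun r => (i r).1.1) k
  refine ⟨a, b, ?_⟩
  simp only [digS] at ha hb
  simp only [approxSq, gridSq, ha, hb]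

/-! ### Positivity of the measure of balls centred on the attractor -/

lemma Tmap_ball {m n : ℕ} (hm : 2 ≤ m) (hmn : m < n) (d : ℕ × ℕ) (y : ℝ × ℝ) {r : ℝ} :
    ball y r ⊆ Tmap m n d ⁻¹' ball (Tmap m n d y) (r / m) := by
  intro z hz
  have hm0 : (0 : ℝ) < m := by positivity
  have hn0 : (0 : ℝ) < n := by exact_mod_cast (by omega : 0 < n)
  have hmn' : (m : ℝ) ≤ n := by exact_mod_cast hmn.le
  rw [mem_ball, Prod.dist_eq, max_lt_iff, Real.dist_eq, Real.dist_eq] at hz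
  rw [mem_preimage, mem_ball, Prod.dist_eq, max_lt_iff, Real.dist_eq, Real.dist_eq]
  simp only [Tmap]
  constructor
  · rw [← sub_div, add_sub_add_right_eq_sub, abs_div, abs_of_pos hn0]
    calc |z.1 - y.1| / n ≤ |z.1 - y.1| / m := div_le_div_of_nonneg_left (abs_nonneg _) hm0 hmn'
      _ < r / m := (div_lt_div_iff_of_pos_right hm0).2 hz.1
  · rw [← sub_div, add_sub_add_right_eq_sub, abs_div, abs_of_pos hm0]
    exact (div_lt_div_iff_of_pos_right hm0).2 hz.2

lemma ball_pos {m n : ℕ} (hm : 2 ≤ m) (hmn : m < n)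
    {D : Finset (ℕ × ℕ)} (hD : ∀ d ∈ D, d.1 < m ∧ d.2 < n)
    {p : ℕ × ℕ → ℝ} (hp : ∀ d ∈ D, 0 < p d) (hp1 : ∑ d ∈ D, p d = 1)
    {μ : Measure (ℝ × ℝ)} (hμ1 : IsProbabilityMeasure μ) (hμ : IsSelfAffine m n D p μ)
    {Λ : Set (ℝ × ℝ)} (hΛ : IsAttractor m n D Λ) (x : ℝ × ℝ) (hx : x ∈ Λ) (r : ℝ) (hr : 0 < r) :
    0 < μ.real (ball x r) := by
  have hm1 : (1 : ℝ) < m := by exact_mod_cast (by omega : 1 < m)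
  obtain ⟨hc, -, heq⟩ := hΛ
  have hbd : Bornology.IsBounded (Λ ∪ boxR 0) :=
    hc.isBounded.union (isCompact_Icc.prod isCompact_Icc).isBounded
  obtain ⟨C, hC⟩ := isBounded_iff.1 hbd
  have key : ∀ k : ℕ, ∀ x ∈ Λ, 0 < μ.real (ball x ((C + 1) / (m : ℝ) ^ k)) := by
    intro k
    induction k with
    | zero =>
      intro x hx
      have : boxR 0 ⊆ ball x ((C + 1) / (m : ℝ) ^ 0) := by
        intro z hz
        have := hC (Or.inr hz) (Or.inl hx)
        rw [mem_ball, pow_zero, div_one]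
        linarith
      have h2 := measureReal_mono (μ := μ) this
      rw [unit_full hm hmn hD hp hp1 hμ1 hμ] at h2
      linarith
    | succ k ih =>
      intro x hx
      rw [heq] at hx
      simp only [mem_iUnion] at hx
      obtain ⟨d, hd, y, hy, rfl⟩ := hx
      rw [real_selfAffine hp hμ1 hμ _ isOpen_ball.measurableSet]
      refine Finset.sum_pos' (fun d hd => mul_nonneg (hp d hd).le measureReal_nonneg) ⟨d, hd, ?_⟩
      refine mul_pos (hp d hd) ((ih y hy).trans_le (measureReal_mono ?_))
      rw [pow_succ, ← div_div]
      exact Tmap_ball hm hmn d y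
  obtain ⟨k, hk⟩ := pow_unbounded_of_one_lt ((C + 1) / r) hm1
  refine (key k x hx).trans_le (measureReal_mono (ball_subset_ball ?_))
  rw [div_le_iff₀ (by positivity)]
  rw [div_lt_iff₀ hr] at hk
  linarith

/-! ### Decay of the measure of horizontal strips -/

/-- Half-open horizontal strip of height `m^{-k}`. -/
def strip (m k : ℕ) (j : ℤ) : Set (ℝ × ℝ) := {z | ⌊(m : ℝ) ^ k * z.2⌋ = j}

lemma measurableSet_strip (m k : ℕ) (j : ℤ) : MeasurableSet (strip m k j) := by
  have : Measurable fun z : ℝ × ℝ => ⌊(m : ℝ) ^ k * z.2⌋ :=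
    Int.measurable_floor.comp (measurable_const.mul measurable_snd)
  exact this (measurableSet_singleton j)

lemma preim_strip {m n : ℕ} (hm : 2 ≤ m) (d : ℕ × ℕ) (k : ℕ) (j : ℤ) :
    Tmap m n d ⁻¹' strip m (k + 1) j = strip m k (j - d.1 * (m : ℤ) ^ k) := by
  ext z
  have hm0 : (m : ℝ) ≠ 0 := by positivity
  have : (m : ℝ) ^ (k + 1) * ((z.2 + d.1) / m) = (m : ℝ) ^ k * z.2 + ((d.1 * (m : ℤ) ^ k : ℤ) : ℝ) := by
    push_cast
    field_simp
    try ring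
  simp only [mem_preimage, strip, mem_ofPred_eq, Tmap]
  rw [this, Int.floor_add_intCast]
  omega

lemma null_of_disjoint {μ : Measure (ℝ × ℝ)} (hμ1 : IsProbabilityMeasure μ) {A B : Set (ℝ × ℝ)}
    (hA : MeasurableSet A) (h1 : μ.real A = 1) (hB : B ⊆ Aᶜ) : μ.real B = 0 := by
  have h2 : μ.real Aᶜ = 0 := by rw [probReal_compl_eq_one_sub hA, h1, sub_self]
  exact le_antisymm (h2 ▸ measureReal_mono hB) measureReal_nonneg

lemma exists_other_row {D : Finset (ℕ × ℕ)} (hrow : ∃ d ∈ D, ∃ d' ∈ D, d.1 ≠ d'.1) (i : ℕ) :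
    ∃ d ∈ D, d.1 ≠ i := by
  obtain ⟨d, hd, d', hd', h⟩ := hrow
  by_cases h1 : d.1 = i
  · exact ⟨d', hd', fun h2 => h (h1.trans h2.symm)⟩
  · exact ⟨d, hd, h1⟩

lemma sum_le_of_zero {D : Finset (ℕ × ℕ)} {p : ℕ × ℕ → ℝ} (hp : ∀ d ∈ D, 0 < p d)
    (hp1 : ∑ d ∈ D, p d = 1) (f : ℕ × ℕ → ℝ) (M : ℝ) (hf : ∀ d ∈ D, f d ≤ M) (d' : ℕ × ℕ)
    (hd' : d' ∈ D) (h0 : f d' ≤ 0) : ∑ d ∈ D, p d * f d ≤ (1 - p d') * M := by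
  rw [← hp1, ← Finset.add_sum_erase D _ hd', ← Finset.add_sum_erase D p hd', add_sub_cancel_left,
    Finset.sum_mul]
  have h1 : p d' * f d' ≤ 0 := mul_nonpos_of_nonneg_of_nonpos (hp d' hd').le h0
  have h2 : ∑ d ∈ D.erase d', p d * f d ≤ ∑ d ∈ D.erase d', p d * M :=
    Finset.sum_le_sum fun d hd => mul_le_mul_of_nonneg_left (hf d (Finset.mem_of_mem_erase hd))
      (hp d (Finset.mem_of_mem_erase hd)).le
  linarith

lemma top_null {m n : ℕ} (hm : 2 ≤ m) (hmn : m < n)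
    {D : Finset (ℕ × ℕ)} (hD : ∀ d ∈ D, d.1 < m ∧ d.2 < n)
    (hrow : ∃ d ∈ D, ∃ d' ∈ D, d.1 ≠ d'.1)
    {p : ℕ × ℕ → ℝ} (hp : ∀ d ∈ D, 0 < p d) (hp1 : ∑ d ∈ D, p d = 1)
    {μ : Measure (ℝ × ℝ)} (hμ1 : IsProbabilityMeasure μ) (hμ : IsSelfAffine m n D p μ) :
    μ.real {z : ℝ × ℝ | z.2 = 1} = 0 := by
  have hu := unit_full hm hmn hD hp hp1 hμ1 hμ
  have hm0 : (0 : ℝ) < m := by positivity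
  obtain ⟨d', hd', hne⟩ := exists_other_row hrow (m - 1)
  have hmeas : MeasurableSet {z : ℝ × ℝ | z.2 = 1} := measurable_snd (measurableSet_singleton 1)
  have hz : ∀ d ∈ D, d.1 ≠ m - 1 → μ.real (Tmap m n d ⁻¹' {z : ℝ × ℝ | z.2 = 1}) = 0 := by
    intro d hd hdm
    refine null_of_disjoint hμ1 (measurableSet_boxR 0) hu fun z hz hz' => ?_
    have h1 : (z.2 + d.1) / m = 1 := hz
    rw [div_eq_one_iff_eq hm0.ne'] at h1
    have h2 : z.2 ≤ 1 + 0 := hz'.2.2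
    have h3 : (d.1 : ℝ) + 2 ≤ m := by
      have := (hD d hd).1
      exact_mod_cast (by omega : d.1 + 2 ≤ m)
    linarith
  have h1 := real_selfAffine hp hμ1 hμ _ hmeas
  have h2 := sum_le_of_zero hp hp1 (fun d => μ.real (Tmap m n d ⁻¹' {z : ℝ × ℝ | z.2 = 1}))
    (μ.real {z : ℝ × ℝ | z.2 = 1}) ?_ d' hd' (hz d' hd' hne).le
  · rw [← h1] at h2
    have := hp d' hd'
    have h0 : 0 ≤ μ.real {z : ℝ × ℝ | z.2 = 1} := measureReal_nonneg
    nlinarith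
  · intro d hd
    by_cases hdm : d.1 = m - 1
    · refine measureReal_mono fun z hz => ?_
      have h1 : (z.2 + d.1) / m = 1 := hz
      rw [div_eq_one_iff_eq hm0.ne'] at h1
      have h3 : (d.1 : ℝ) + 1 = m := by exact_mod_cast (by omega : d.1 + 1 = m)
      show z.2 = 1
      linarith
    · rw [hz d hd hdm]; exact measureReal_nonneg

lemma strip_null {m n : ℕ} (hm : 2 ≤ m) (hmn : m < n)
    {D : Finset (ℕ × ℕ)} (hD : ∀ d ∈ D, d.1 < m ∧ d.2 < n)
    (hrow : ∃ d ∈ D, ∃ d' ∈ D, d.1 ≠ d'.1)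
    {p : ℕ × ℕ → ℝ} (hp : ∀ d ∈ D, 0 < p d) (hp1 : ∑ d ∈ D, p d = 1)
    {μ : Measure (ℝ × ℝ)} (hμ1 : IsProbabilityMeasure μ) (hμ : IsSelfAffine m n D p μ)
    (k : ℕ) (j : ℤ) (hj : j < 0 ∨ (m : ℤ) ^ k ≤ j) : μ.real (strip m k j) = 0 := by
  have hu := unit_full hm hmn hD hp hp1 hμ1 hμ
  have ht := top_null hm hmn hD hrow hp hp1 hμ1 hμ
  have hm0 : (0 : ℝ) < (m : ℝ) ^ k := by positivity
  have hsub : strip m k j ⊆ {z : ℝ × ℝ | z.2 = 1} ∪ (boxR 0)ᶜ := by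
    intro z hz
    by_contra hcon
    rw [mem_union, not_or, notMem_compl_iff] at hcon
    obtain ⟨h1, -, h2, h3⟩ := hcon
    have h4 : ⌊(m : ℝ) ^ k * z.2⌋ = j := hz
    have h5 : z.2 < 1 := lt_of_le_of_ne (by linarith) h1
    have h2' : 0 ≤ z.2 := by linarith
    rcases hj with hj | hj
    · have : (0 : ℤ) ≤ ⌊(m : ℝ) ^ k * z.2⌋ := Int.floor_nonneg.2 (by positivity)
      omega
    · have h6 : ⌊(m : ℝ) ^ k * z.2⌋ < (m : ℤ) ^ k := by
        rw [Int.floor_lt]; push_cast; nlinarith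
      omega
  have h2 : μ.real (boxR 0)ᶜ = 0 := null_of_disjoint hμ1 (measurableSet_boxR 0) hu Subset.rfl
  have h3 := (measureReal_mono (μ := μ) hsub).trans (measureReal_union_le _ _)
  rw [ht, h2, add_zero] at h3
  exact le_antisymm h3 measureReal_nonneg

lemma strip_decay {m n : ℕ} (hm : 2 ≤ m) (hmn : m < n)
    {D : Finset (ℕ × ℕ)} (hD : ∀ d ∈ D, d.1 < m ∧ d.2 < n)
    (hrow : ∃ d ∈ D, ∃ d' ∈ D, d.1 ≠ d'.1)
    {p : ℕ × ℕ → ℝ} (hp : ∀ d ∈ D, 0 < p d) (hp1 : ∑ d ∈ D, p d = 1)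
    {μ : Measure (ℝ × ℝ)} (hμ1 : IsProbabilityMeasure μ) (hμ : IsSelfAffine m n D p μ) :
    ∃ q : ℝ, 0 < q ∧ q < 1 ∧ ∀ (k : ℕ) (j : ℤ), μ.real (strip m k j) ≤ q ^ k := by
  have hne : D.Nonempty := ⟨_, hrow.choose_spec.1⟩
  obtain ⟨d₀, hd₀, hmin⟩ := Finset.exists_min_image D p hne
  have hlt : p d₀ < 1 := by
    obtain ⟨d', hd', h⟩ := exists_other_row hrow d₀.1
    have hne' : d' ≠ d₀ := fun e => h (by rw [e])
    rw [← hp1]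
    exact Finset.single_lt_sum hne' hd₀ hd' (hp d' hd') fun k hk _ => (hp k hk).le
  refine ⟨1 - p d₀, by linarith, by linarith [hp d₀ hd₀], fun k => ?_⟩
  induction k with
  | zero => intro j; rw [pow_zero]; exact measureReal_le_one
  | succ k ih =>
    intro j
    rw [real_selfAffine hp hμ1 hμ _ (measurableSet_strip m (k + 1) j)]
    simp only [preim_strip hm]
    have hq : 0 ≤ (1 - p d₀) ^ k := pow_nonneg (by linarith) k
    obtain ⟨d', hd', hz⟩ : ∃ d' ∈ D, μ.real (strip m k (j - d'.1 * (m : ℤ) ^ k)) = 0 := by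
      by_contra! hcon
      have hM : (0 : ℤ) < (m : ℤ) ^ k := by positivity
      have hrange : ∀ d ∈ D, 0 ≤ j - d.1 * (m : ℤ) ^ k ∧ j - d.1 * (m : ℤ) ^ k < (m : ℤ) ^ k := by
        intro d hd
        by_contra h
        refine hcon d hd (strip_null hm hmn hD hrow hp hp1 hμ1 hμ _ _ ?_)
        by_contra h'
        push Not at h'
        exact h h'
      obtain ⟨a, ha, b, hb, hab⟩ := hrow
      have h1 := hrange a ha
      have h2 := hrange b hb
      rcases lt_or_gt_of_ne hab with h | h
      · have : (a.1 : ℤ) + 1 ≤ b.1 := by exact_mod_cast h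
        nlinarith
      · have : (b.1 : ℤ) + 1 ≤ a.1 := by exact_mod_cast h
        nlinarith
    refine (sum_le_of_zero hp hp1 (fun d => μ.real (strip m k (j - d.1 * (m : ℤ) ^ k)))
      ((1 - p d₀) ^ k) (fun d _ => ih _) d' hd' hz.le).trans ?_
    rw [pow_succ, mul_comm]
    exact mul_le_mul_of_nonneg_left (by linarith [hmin d' hd']) hq

lemma ball_decay {m : ℕ} (hm : 2 ≤ m) {μ : Measure (ℝ × ℝ)} (hμ1 : IsProbabilityMeasure μ)
    {q : ℝ} (h : ∀ (k : ℕ) (j : ℤ), μ.real (strip m k j) ≤ q ^ k) (x : ℝ × ℝ) (k : ℕ) :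
    μ.real (ball x (1 * (m : ℝ) ^ (-(k : ℝ)))) ≤ 3 * q ^ k := by
  have hM : (0 : ℝ) < (m : ℝ) ^ k := by positivity
  set j := ⌊(m : ℝ) ^ k * x.2⌋ with hj
  have hsub : ball x (1 * (m : ℝ) ^ (-(k : ℝ))) ⊆
      (strip m k (j - 1) ∪ strip m k j) ∪ strip m k (j + 1) := by
    intro z hz
    rw [mem_ball, Prod.dist_eq, max_lt_iff, Real.dist_eq, Real.dist_eq, one_mul,
      Real.rpow_neg (by positivity), Real.rpow_natCast, ← one_div, lt_div_iff₀ hM] at hz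
    have h2 := hz.2
    rw [lt_div_iff₀ hM] at h2
    rw [← abs_of_pos hM, ← abs_mul, abs_lt] at h2
    have f1 := Int.floor_le ((m : ℝ) ^ k * x.2)
    have f2 := Int.lt_floor_add_one ((m : ℝ) ^ k * x.2)
    rw [← hj] at f1 f2
    have g1 : j - 1 ≤ ⌊(m : ℝ) ^ k * z.2⌋ := by
      rw [Int.le_floor]; push_cast; nlinarith
    have g2 : ⌊(m : ℝ) ^ k * z.2⌋ < j + 2 := by
      rw [Int.floor_lt]; push_cast; nlinarith
    simp only [strip, mem_union, mem_ofPred_eq]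
    omega
  have h1 := measureReal_mono (μ := μ) hsub
  have h2 := measureReal_union_le (μ := μ) (strip m k (j - 1) ∪ strip m k j) (strip m k (j + 1))
  have h3 := measureReal_union_le (μ := μ) (strip m k (j - 1)) (strip m k j)
  linarith [h k (j - 1), h k j, h k (j + 1)]

/-! ### Asymptotics -/

lemma localDim_seq {m : ℕ} (hm : 2 ≤ m) {μ : Measure (ℝ × ℝ)} {x : ℝ × ℝ} {α : ℝ}
    (h : HasLocalDim μ x α) (c M : ℝ) (hc : 0 < c) :
    Tendsto (fun k : ℕ => (Real.log (μ.real (ball x (c * (m : ℝ) ^ (-(k : ℝ))))) - Real.log M) /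
      ((k : ℝ) * Real.log m)) atTop (𝓝 (-α)) := by
  have hm1 : (1 : ℝ) < m := by exact_mod_cast (by omega : 1 < m)
  have hm0 : (0 : ℝ) < m := by linarith
  have lm : 0 < Real.log m := Real.log_pos hm1
  have hk : Tendsto (fun k : ℕ => (k : ℝ) * Real.log m) atTop atTop :=
    tendsto_natCast_atTop_atTop.atTop_mul_const lm
  have hr : Tendsto (fun k : ℕ => c * (m : ℝ) ^ (-(k : ℝ))) atTop (𝓝[>] 0) := by
    refine tendsto_nhdsWithin_iff.2 ⟨?_, Eventually.of_forall fun k => ?_⟩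
    · have h1 : Tendsto (fun k : ℕ => ((m : ℝ)⁻¹) ^ k) atTop (𝓝 0) :=
        tendsto_pow_atTop_nhds_zero_of_lt_one (by positivity) (inv_lt_one_of_one_lt₀ hm1)
      have h2 := h1.const_mul c
      rw [mul_zero] at h2
      refine h2.congr fun k => ?_
      rw [Real.rpow_neg hm0.le, Real.rpow_natCast, inv_pow]
    · exact mul_pos hc (Real.rpow_pos_of_pos hm0 _)
  have hlog : ∀ k : ℕ, Real.log (c * (m : ℝ) ^ (-(k : ℝ))) = Real.log c - k * Real.log m := by
    intro k
    rw [Real.log_mul hc.ne' (Real.rpow_pos_of_pos hm0 _).ne', Real.log_rpow hm0]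
    ring
  have h1 := h.comp hr
  have h2 : Tendsto (fun k : ℕ => (Real.log c - k * Real.log m) / ((k : ℝ) * Real.log m)) atTop
      (𝓝 (0 - 1)) := by
    refine ((hk.const_div_atTop (Real.log c)).sub_const 1).congr' ?_
    filter_upwards [hk.eventually_gt_atTop 0] with k hk0
    rw [sub_div, div_self hk0.ne']
  have h3 := (h1.mul h2).sub (hk.const_div_atTop (Real.log M))
  rw [show α * (0 - 1) - 0 = -α by ring] at h3
  refine h3.congr' ?_
  filter_upwards [hk.eventually_gt_atTop 0, hk.eventually_gt_atTop (Real.log c)] with k hk0 hk1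
  have hne : Real.log c - k * Real.log m ≠ 0 := by linarith
  simp only [Function.comp_apply, hlog, measureReal_def]
  rw [div_mul_div_cancel₀ hne, sub_div]

lemma alpha_pos {m n : ℕ} (hm : 2 ≤ m) (hmn : m < n)
    {D : Finset (ℕ × ℕ)} (hD : ∀ d ∈ D, d.1 < m ∧ d.2 < n)
    (hrow : ∃ d ∈ D, ∃ d' ∈ D, d.1 ≠ d'.1)
    {p : ℕ × ℕ → ℝ} (hp : ∀ d ∈ D, 0 < p d) (hp1 : ∑ d ∈ D, p d = 1)
    {μ : Measure (ℝ × ℝ)} (hμ1 : IsProbabilityMeasure μ) (hμ : IsSelfAffine m n D p μ)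
    {Λ : Set (ℝ × ℝ)} (hΛ : IsAttractor m n D Λ) {x : ℝ × ℝ} {α : ℝ} (hx : x ∈ levelSet μ Λ α) :
    0 < α := by
  have hm1 : (1 : ℝ) < m := by exact_mod_cast (by omega : 1 < m)
  have lm : 0 < Real.log m := Real.log_pos hm1
  obtain ⟨q, q0, q1, hq⟩ := strip_decay hm hmn hD hrow hp hp1 hμ1 hμ
  have hlim := localDim_seq hm hx.2 1 3 one_pos
  have hle : -α ≤ Real.log q / Real.log m := by
    refine le_of_tendsto hlim ?_
    filter_upwards [eventually_gt_atTop 0] with k hk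
    have hk' : (0 : ℝ) < k := by exact_mod_cast hk
    have hpos := ball_pos hm hmn hD hp hp1 hμ1 hμ hΛ x hx.1 (1 * (m : ℝ) ^ (-(k : ℝ))) (by positivity)
    have h1 := Real.log_le_log hpos (ball_decay hm hμ1 hq x k)
    rw [Real.log_mul (by norm_num) (by positivity), Real.log_pow] at h1
    rw [div_le_div_iff₀ (by positivity) lm]
    nlinarith
  have : Real.log q / Real.log m < 0 := div_neg_of_neg_of_pos (Real.log_neg q0 q1) lm
  linarith

/-! ### Geometry of approximate squares near a point -/

lemma D1_bounds (n : ℕ) : 0 < D1 n ∧ D1 n ≤ n + 1 := by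
  have hn : (0 : ℝ) ≤ n := by positivity
  refine ⟨Real.sqrt_pos.2 (by positivity), Real.sqrt_le_iff.2 ⟨by positivity, by nlinarith⟩⟩

/-- One-dimensional position estimate. -/
lemma grid_index {w z x r : ℝ} {a : ℤ} {c : ℝ} (hw : 0 < w) (hz : z ∈ Icc (a * w) (a * w + w))
    (hzx : |z - x| < r) (hr : r ≤ c * w) : |((a - ⌊x / w⌋ : ℤ) : ℝ)| ≤ c + 1 := by
  have f1 := Int.floor_le (x / w)
  have f2 := Int.lt_floor_add_one (x / w)
  rw [le_div_iff₀ hw] at f1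
  rw [div_lt_iff₀ hw] at f2
  rw [abs_lt] at hzx
  obtain ⟨z1, z2⟩ := hz
  rw [abs_le]
  push_cast
  constructor
  · refine le_of_mul_le_mul_right ?_ hw
    nlinarith
  · refine le_of_mul_le_mul_right ?_ hw
    nlinarith

lemma good_square {m n : ℕ} (hm : 2 ≤ m) (hmn : m < n)
    {D : Finset (ℕ × ℕ)} (hD : ∀ d ∈ D, d.1 < m ∧ d.2 < n) (hne : D.Nonempty)
    {p : ℕ × ℕ → ℝ} (hp : ∀ d ∈ D, 0 < p d) (hp1 : ∑ d ∈ D, p d = 1)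
    {μ : Measure (ℝ × ℝ)} (hμ1 : IsProbabilityMeasure μ) (hμ : IsSelfAffine m n D p μ)
    (x : ℝ × ℝ) (k : ℕ) (hpos : 0 < μ.real (ball x (D1 n / 2 * (m : ℝ) ^ (-(k : ℝ))))) :
    ∃ i : Word D, (∃ z ∈ approxSq m n k i, dist x z < D1 n / 2 * (m : ℝ) ^ (-(k : ℝ))) ∧
      μ.real (ball x (D1 n / 2 * (m : ℝ) ^ (-(k : ℝ)))) ≤
        (2 * ((n : ℝ) + 3) + 1) ^ 2 * μ.real (approxSq m n k i) := by
  classical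
  by_contra! hcon
  set r := D1 n / 2 * (m : ℝ) ^ (-(k : ℝ)) with hr
  have hmk : (m : ℝ) ^ (-(k : ℝ)) = (m : ℝ) ^ (-(k : ℤ)) := by
    rw [← Real.rpow_intCast]; push_cast; rfl
  obtain ⟨-, lk1, -⟩ := lk_bounds m n hm hmn k
  have hn0 : (0 : ℝ) < n := by exact_mod_cast (by omega : 0 < n)
  set u := (n : ℝ) ^ (-(lk m n k : ℤ)) with hu
  set v := (m : ℝ) ^ (-(k : ℤ)) with hv
  have u0 : 0 < u := by positivity
  have v0 : 0 < v := by positivity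
  obtain ⟨hD0, hD2⟩ := D1_bounds n
  have hrv : r ≤ ((n : ℝ) + 1) / 2 * v := by
    rw [hr, hmk]; gcongr
  have hru : r ≤ ((n : ℝ) + 1) / 2 * u := hrv.trans (by gcongr)
  let F : Finset (ℤ × ℤ) := Finset.Icc (-((n : ℤ) + 3)) (n + 3) ×ˢ Finset.Icc (-((n : ℤ) + 3)) (n + 3)
  let G : ℤ × ℤ → Set (ℝ × ℝ) := fun ab =>
    if ∃ i : Word D, approxSq m n k i = gridSq m n k (⌊x.1 / u⌋ + ab.1) (⌊x.2 / v⌋ + ab.2) ∧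
      ∃ z ∈ approxSq m n k i, dist x z < r
    then gridSq m n k (⌊x.1 / u⌋ + ab.1) (⌊x.2 / v⌋ + ab.2) else ∅
  have hcard : (F.card : ℝ) = (2 * ((n : ℝ) + 3) + 1) ^ 2 := by
    have h1 : (Finset.Icc (-((n : ℤ) + 3)) (n + 3)).card = 2 * (n + 3) + 1 := by
      rw [Int.card_Icc]; omega
    rw [Finset.card_product, h1]
    push_cast
    ring
  have hFne : F.Nonempty := ⟨(0, 0), by simp [F]; omega⟩
  have hC0 : 0 < (2 * ((n : ℝ) + 3) + 1) ^ 2 := by positivity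
  -- covering
  have hcov : ball x r ⊆ (⋃ ab ∈ F, G ab) ∪ (levS m n D k)ᶜ := by
    intro z hz
    by_cases hzS : z ∈ levS m n D k
    · left
      obtain ⟨i, hi⟩ := levS_sq hm hmn hne hD k z hzS
      obtain ⟨a, b, hab⟩ := approxSq_grid hm hmn k i
      have hzg := hi
      rw [hab] at hzg
      rw [mem_ball, Prod.dist_eq, max_lt_iff, Real.dist_eq, Real.dist_eq] at hz
      have g1 := grid_index u0 hzg.1 hz.1 hru
      have g2 := grid_index v0 hzg.2 hz.2 hrv
      rw [abs_le] at g1 g2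
      have hF : (a - ⌊x.1 / u⌋, b - ⌊x.2 / v⌋) ∈ F := by
        simp only [F, Finset.mem_product, Finset.mem_Icc]
        refine ⟨⟨?_, ?_⟩, ⟨?_, ?_⟩⟩
        · have : (-((n : ℝ) + 3)) ≤ ((a - ⌊x.1 / u⌋ : ℤ) : ℝ) := by linarith [g1.1]
          exact_mod_cast this
        · have : ((a - ⌊x.1 / u⌋ : ℤ) : ℝ) ≤ (n : ℝ) + 3 := by linarith [g1.2]
          exact_mod_cast this
        · have : (-((n : ℝ) + 3)) ≤ ((b - ⌊x.2 / v⌋ : ℤ) : ℝ) := by linarith [g2.1]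
          exact_mod_cast this
        · have : ((b - ⌊x.2 / v⌋ : ℤ) : ℝ) ≤ (n : ℝ) + 3 := by linarith [g2.2]
          exact_mod_cast this
      refine mem_biUnion (show _ ∈ (F : Set (ℤ × ℤ)) from hF) ?_
      have hcond : ∃ i : Word D, approxSq m n k i =
          gridSq m n k (⌊x.1 / u⌋ + (a - ⌊x.1 / u⌋)) (⌊x.2 / v⌋ + (b - ⌊x.2 / v⌋)) ∧
          ∃ z ∈ approxSq m n k i, dist x z < r := by
        refine ⟨i, by rw [hab, add_sub_cancel, add_sub_cancel], z, hi, ?_⟩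
        rw [dist_comm, Prod.dist_eq, max_lt_iff, Real.dist_eq, Real.dist_eq]
        exact hz
      simp only [G]
      rw [if_pos hcond, add_sub_cancel, add_sub_cancel]
      exact hzg
    · exact Or.inr hzS
  have h0 : μ.real (levS m n D k)ᶜ = 0 :=
    null_of_disjoint hμ1 (levS_compact m n D k).measurableSet
      (levS_full hm hmn hD hp hp1 hμ1 hμ k) Subset.rfl
  have h1 : μ.real (ball x r) ≤ ∑ ab ∈ F, μ.real (G ab) := by
    have e1 := (measureReal_mono (μ := μ) hcov).trans (measureReal_union_le _ _)
    rw [h0, add_zero] at e1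
    exact e1.trans (measureReal_biUnion_finset_le _ _)
  have h2 : ∑ ab ∈ F, μ.real (G ab) < ∑ ab ∈ F, μ.real (ball x r) / (2 * ((n : ℝ) + 3) + 1) ^ 2 := by
    refine Finset.sum_lt_sum_of_nonempty hFne fun ab _ => ?_
    simp only [G]
    split_ifs with hc
    · obtain ⟨i, hi, hz⟩ := hc
      rw [← hi, lt_div_iff₀ hC0, mul_comm]
      exact hcon i hz
    · rw [measureReal_empty]
      positivity
  rw [Finset.sum_const, nsmul_eq_mul, hcard, mul_div_cancel₀ _ hC0.ne'] at h2
  linarith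

lemma square_subset {m n : ℕ} (hm : 2 ≤ m) (hmn : m < n) {D : Finset (ℕ × ℕ)}
    (x : ℝ × ℝ) (k : ℕ) (i : Word D)
    (h : ∃ z ∈ approxSq m n k i, dist x z < D1 n / 2 * (m : ℝ) ^ (-(k : ℝ))) :
    approxSq m n k i ⊆ ball x ((2 * (n : ℝ) + 1) * (m : ℝ) ^ (-(k : ℝ))) := by
  have hmk : (m : ℝ) ^ (-(k : ℝ)) = (m : ℝ) ^ (-(k : ℤ)) := by
    rw [← Real.rpow_intCast]; push_cast; rfl
  obtain ⟨-, -, lk2⟩ := lk_bounds m n hm hmn k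
  have hn1 : (1 : ℝ) ≤ n := by exact_mod_cast (by omega : 1 ≤ n)
  rw [hmk] at h ⊢
  set u := (n : ℝ) ^ (-(lk m n k : ℤ)) with hu
  set v := (m : ℝ) ^ (-(k : ℤ)) with hv
  have v0 : 0 < v := by positivity
  obtain ⟨hD0, hD2⟩ := D1_bounds n
  obtain ⟨z, hz, hd⟩ := h
  obtain ⟨a, b, hab⟩ := approxSq_grid hm hmn k i
  rw [hab] at hz ⊢
  intro w hw
  obtain ⟨⟨z1, z2⟩, ⟨z3, z4⟩⟩ := hz
  obtain ⟨⟨w1, w2⟩, ⟨w3, w4⟩⟩ := hw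
  rw [← hu] at z1 z2 w1 w2
  rw [← hv] at z3 z4 w3 w4
  have hd' : dist x z < ((n : ℝ) + 1) / 2 * v := hd.trans_le (by gcongr)
  rw [Prod.dist_eq, max_lt_iff, Real.dist_eq, Real.dist_eq, abs_lt, abs_lt] at hd'
  rw [mem_ball, Prod.dist_eq, max_lt_iff, Real.dist_eq, Real.dist_eq, abs_lt, abs_lt]
  obtain ⟨⟨d1, d2⟩, ⟨d3, d4⟩⟩ := hd'
  have hnv : v ≤ n * v := by nlinarith
  refine ⟨⟨?_, ?_⟩, ⟨?_, ?_⟩⟩ <;> linarith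

theorem close_squares_in_Y
    (m n : ℕ) (hm : 2 ≤ m) (hmn : m < n)
    (D : Finset (ℕ × ℕ)) (hD : ∀ d ∈ D, d.1 < m ∧ d.2 < n)
    (hrow : ∃ d ∈ D, ∃ d' ∈ D, d.1 ≠ d'.1)
    (hcol : ∃ d ∈ D, ∃ d' ∈ D, d.2 ≠ d'.2)
    (p : ℕ × ℕ → ℝ) (hp : ∀ d ∈ D, 0 < p d) (hp1 : ∑ d ∈ D, p d = 1)
    (μ : Measure (ℝ × ℝ)) (hμ1 : IsProbabilityMeasure μ) (hμ : IsSelfAffine m n D p μ)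
    (Λ : Set (ℝ × ℝ)) (hΛ : IsAttractor m n D Λ)
 :
    ∀ (α ε : ℝ), 0 < ε → ∀ x ∈ levelSet μ Λ α,
      ∃ K : ℕ, ∀ k ≥ K, ∃ i : Word D,
        infDist x (approxSq m n k i) ≤ D1 n * (m : ℝ) ^ (-(k : ℝ)) / 2 ∧
          MemY m n μ α ε k i := by
  intro α ε hε x hx
  have hm1 : (1 : ℝ) < m := by exact_mod_cast (by omega : 1 < m)
  have hm0 : (0 : ℝ) < m := by linarith
  have lm : 0 < Real.log m := Real.log_pos hm1
  have hne : D.Nonempty := ⟨_, hrow.choose_spec.1⟩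
  have hα := alpha_pos hm hmn hD hrow hp hp1 hμ1 hμ hΛ hx
  obtain ⟨hD0, hD2⟩ := D1_bounds n
  have hM : 0 < (2 * ((n : ℝ) + 3) + 1) ^ 2 := by positivity
  have l1 := localDim_seq hm hx.2 (D1 n / 2) ((2 * ((n : ℝ) + 3) + 1) ^ 2) (by positivity)
  have l2 := localDim_seq hm hx.2 (2 * (n : ℝ) + 1) 1 (by positivity)
  have e1 := l1.eventually (lt_mem_nhds (show -(α * (1 + ε)) < -α by nlinarith))
  have e2 := l2.eventually (gt_mem_nhds (show -α < -(α * (1 - ε)) by nlinarith))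
  obtain ⟨K, hK⟩ := eventually_atTop.1 ((e1.and e2).and (eventually_gt_atTop 0))
  refine ⟨K, fun k hk => ?_⟩
  obtain ⟨⟨h1, h2⟩, hk0⟩ := hK k hk
  have hk' : (0 : ℝ) < k := by exact_mod_cast hk0
  have hkl : 0 < (k : ℝ) * Real.log m := by positivity
  have hp1' := ball_pos hm hmn hD hp hp1 hμ1 hμ hΛ x hx.1
    (D1 n / 2 * (m : ℝ) ^ (-(k : ℝ))) (by positivity)
  have hp2' := ball_pos hm hmn hD hp hp1 hμ1 hμ hΛ x hx.1
    ((2 * (n : ℝ) + 1) * (m : ℝ) ^ (-(k : ℝ))) (by positivity)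
  obtain ⟨i, hi, hle⟩ := good_square hm hmn hD hne hp hp1 hμ1 hμ x k hp1'
  refine ⟨i, ?_, ?_, ?_⟩
  · obtain ⟨z, hz, hd⟩ := hi
    refine (infDist_le_dist_of_mem hz).trans (hd.le.trans (le_of_eq ?_))
    ring
  · rw [← ofReal_measureReal (measure_ne_top _ _)]
    refine ENNReal.ofReal_le_ofReal ?_
    rw [lt_div_iff₀ hkl, ← Real.log_div hp1'.ne' hM.ne'] at h1
    have h3 : (m : ℝ) ^ (-((k : ℝ) * α * (1 + ε))) <
        μ.real (ball x (D1 n / 2 * (m : ℝ) ^ (-(k : ℝ)))) / (2 * ((n : ℝ) + 3) + 1) ^ 2 := by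
      rw [← Real.log_lt_log_iff (Real.rpow_pos_of_pos hm0 _) (div_pos hp1' hM), Real.log_rpow hm0]
      refine lt_of_eq_of_lt ?_ h1
      ring
    refine h3.le.trans ?_
    rw [div_le_iff₀ hM]
    linarith
  · rw [← ofReal_measureReal (measure_ne_top _ _)]
    refine ENNReal.ofReal_le_ofReal ?_
    refine (measureReal_mono (square_subset hm hmn x k i hi)).trans ?_
    rw [div_lt_iff₀ hkl, Real.log_one, sub_zero] at h2
    rw [← Real.log_le_log_iff hp2' (Real.rpow_pos_of_pos hm0 _), Real.log_rpow hm0]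
    refine h2.le.trans (le_of_eq ?_)
    ring

end BedfordMcMullen
end
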